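/- arXiv:1602.08965 — 7 statements merged into one kernel-verified Lean document; each statement's English description precedes it below -/
import Mathlib

section
/- Let w be a 132-avoiding word representing a finite simple graph G (so the vertex set of G is A(w) and adjacency equals alternation in w). If x is a vertex of G whose degree in G is at least 2, then x occurs at most twice in w, i.e., n_w(x) ≤ 2. -/
/-- Distinct letters `x` and `y` alternate in the word `w`: the subsequence of `w`
formed by all occurrences of `x` and `y` has no two equal consecutive letters. -/
def Alternate (w : List ℕ) (x y : ℕ) : Prop :=
  (w.filter (fun c => decide (c = x ∨ c = y))).Chain' (· ≠ ·)

/-- The word `w` avoids the pattern 132. -/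
def Avoids132 (w : List ℕ) : Prop :=
  ∀ i j k : Fin w.length, i < j → j < k →
    ¬ (w.get i < w.get k ∧ w.get k < w.get j)

/-- The word `w` represents the simple graph `G`: the vertex set of `G` is the set
`A(w)` of letters of `w` (all other vertices of the ambient type `ℕ` are isolated),
and two distinct letters of `w` are adjacent iff they alternate in `w`. -/
def Represents (w : List ℕ) (G : SimpleGraph ℕ) : Prop :=
  (∀ x y, G.Adj x y → x ∈ w) ∧
  (∀ x y : ℕ, x ≠ y → x ∈ w → y ∈ w → (G.Adj x y ↔ Alternate w x y))

/-- A graph is 132-representable if some simple graph on a set of natural numbers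
isomorphic to it is represented by a 132-avoiding word. -/
def Representable132 {V : Type*} (G : SimpleGraph V) : Prop :=
  ∃ (w : List ℕ) (H : SimpleGraph ℕ), Avoids132 w ∧ Represents w H ∧
    Nonempty (G ≃g H.induce (↑w.toFinset : Set ℕ))

theorem Avoids132.not_sublist {w : List ℕ} (hw : Avoids132 w) {p q r : ℕ}
    (hpr : p < r) (hrq : r < q) : ¬ [p, q, r].Sublist w := by
  intro h
  obtain ⟨f, hf⟩ := List.sublist_iff_exists_fin_orderEmbedding_get_eq.1 h
  refine hw (f 0) (f 1) (f 2) (f.strictMono ?_) (f.strictMono ?_) ?_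
  · exact Fin.mk_lt_mk.2 Nat.zero_lt_one
  · exact Fin.mk_lt_mk.2 (Nat.lt_succ_self 1)
  rw [← hf, ← hf, ← hf]
  exact ⟨hpr, hrq⟩

/-- A letter alternating with `x` occurs between any two occurrences of `x`. -/
theorem Alternate.mem_of_eq_append {w a b c : List ℕ} {x y : ℕ} (h : Alternate w x y)
    (hw : w = a ++ x :: (b ++ x :: c)) : y ∈ b := by
  by_contra hy
  subst hw
  have hb : ∀ e ∈ b.filter (fun c => decide (c = x ∨ c = y)), e = x := by
    intro e he
    obtain ⟨heb, he⟩ := List.mem_filter.1 he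
    rcases of_decide_eq_true he with rfl | rfl
    · rfl
    · exact absurd heb hy
  unfold Alternate at h
  simp only [List.filter_append, List.filter_cons, true_or, decide_true, if_true] at h
  have h' := h.right_of_append
  cases hl : b.filter (fun c => decide (c = x ∨ c = y)) with
  | nil =>
    rw [hl] at h'
    simp at h'
  | cons e l =>
    obtain rfl := hb e (by rw [hl]; exact List.mem_cons_self)
    rw [hl] at h'
    simp at h'

theorem exists_eq_append_of_three_le_count {α : Type*} [BEq α] [LawfulBEq α] {w : List α} {x : α}
    (h : 3 ≤ w.count x) : ∃ a b c d, w = a ++ x :: (b ++ x :: (c ++ x :: d)) := by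
  have h3 : [x, x, x].Sublist w := List.replicate_sublist_iff.2 h
  obtain ⟨r₁, r₂, rfl, h₁, h2⟩ := List.cons_sublist_iff.1 h3
  obtain ⟨s₁, s₂, rfl, h₂, h1⟩ := List.cons_sublist_iff.1 h2
  obtain ⟨a, a', rfl⟩ := List.append_of_mem h₁
  obtain ⟨b, b', rfl⟩ := List.append_of_mem h₂
  obtain ⟨c, d, rfl⟩ := List.append_of_mem (List.singleton_sublist.1 h1)
  exact ⟨a, a' ++ b, b' ++ c, d, by simp⟩

/-- If a 132-avoiding word `w` represents a graph `G` and `x` is a vertex of `G`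
of degree at least 2, then `x` occurs at most twice in `w`. -/
theorem count_le_two_of_degree_ge_two (w : List ℕ) (G : SimpleGraph ℕ)
    (hw : Avoids132 w) (hrep : Represents w G)
    (x : ℕ) (hx : x ∈ w) (hdeg : 2 ≤ (G.neighborSet x).ncard) :
    w.count x ≤ 2 := by
  by_contra! hc
  obtain ⟨a, b, c, d, rfl⟩ := exists_eq_append_of_three_le_count hc
  have hfin : (G.neighborSet x).Finite := Set.finite_of_ncard_pos (by omega)
  obtain ⟨u, v, hu, hv, huv⟩ := (Set.one_lt_ncard_iff hfin).1 hdeg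
  have gaps : ∀ y, G.Adj x y → y ∈ b ∧ y ∈ c := fun y hy => by
    have halt := (hrep.2 x y hy.ne hx (hrep.1 y x hy.symm)).1 hy
    refine ⟨halt.mem_of_eq_append rfl, ?_⟩
    exact Alternate.mem_of_eq_append halt (a := a ++ x :: b) (c := d) (by simp)
  have key : ∀ y z, G.Adj x y → G.Adj x z → ¬ y < z := fun y z hy hz hyz => by
    obtain ⟨hyb, hyc⟩ := gaps y hy
    obtain ⟨hzb, hzc⟩ := gaps z hz
    rcases lt_or_gt_of_ne hy.ne with hxy | hyx
    · refine hw.not_sublist hxy hyz (.trans ?_ (List.sublist_append_right a _))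
      refine .cons_cons x (.append (List.singleton_sublist.2 hzb) ?_)
      exact .cons x (List.singleton_sublist.2 (by simp [hyc]))
    · rcases lt_or_gt_of_ne hz.ne with hxz | hzx
      · refine hw.not_sublist hyx hxz (.trans ?_ (List.sublist_append_right a _))
        refine .cons x (.append (List.singleton_sublist.2 hyb) (.cons x ?_))
        exact .append (List.singleton_sublist.2 hzc) (List.singleton_sublist.2 (by simp))
      · refine hw.not_sublist hyz hzx (.trans ?_ (List.sublist_append_right a _))
        refine .cons x (.append (List.singleton_sublist.2 hyb) (.cons_cons x ?_))
        exact List.singleton_sublist.2 (by simp [hzc])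
  rcases lt_or_gt_of_ne huv with h | h
  · exact key u v hu hv h
  · exact key v u hv hu h
end

section
/- Let w be a 132-avoiding word representing a finite simple graph G (so the vertex set of G is A(w) and adjacency equals alternation in w). If every vertex of G has degree at least 2 in G, then the length of w is at most 2n, where n = |A(w)| is the number of vertices of G. -/
/-- Between any two occurrences of `x` there is a `y` if `x` and `y` alternate. -/
theorem Alternate.mem_between {x y : ℕ} {p q r : List ℕ}
    (h : Alternate (p ++ x :: (q ++ x :: r)) x y) : y ∈ q := by
  unfold Alternate at h
  simp only [List.filter_append, List.filter_cons, true_or, decide_true, if_true] at h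
  have h' := (List.isChain_append.1 h).2.1
  rcases hq : q.filter (fun c => decide (c = x ∨ c = y)) with _ | ⟨c, t⟩
  · rw [hq] at h'
    simp at h'
  · rw [hq, List.cons_append, List.isChain_cons_cons] at h'
    have hc : c ∈ q.filter (fun c => decide (c = x ∨ c = y)) := by rw [hq]; exact List.mem_cons_self
    obtain ⟨hcq, hcxy⟩ := List.mem_filter.1 hc
    rcases of_decide_eq_true hcxy with rfl | rfl
    · exact absurd rfl h'.1
    · exact hcq

open scoped List in
theorem Avoids132.not_sublist_s1 {w : List ℕ} (hw : Avoids132 w) {a b c : ℕ}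
    (hab : a < b) (hbc : b < c) : ¬ [a, c, b] <+ w := by
  intro h
  obtain ⟨f, hf⟩ := List.sublist_iff_exists_fin_orderEmbedding_get_eq.1 h
  refine hw (f ⟨0, by simp⟩) (f ⟨1, by simp⟩) (f ⟨2, by simp⟩)
    (f.lt_iff_lt.2 (by simp)) (f.lt_iff_lt.2 (by simp)) ?_
  rw [← hf, ← hf, ← hf]
  exact ⟨hab, hbc⟩

open scoped List in
/-- A letter with two distinct neighbours occurs at most twice in a 132-avoiding word. -/
theorem Avoids132.count_le_two {w : List ℕ} (hw : Avoids132 w) {x y z : ℕ}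
    (hxy : x ≠ y) (hxz : x ≠ z) (hyz : y ≠ z)
    (hy : Alternate w x y) (hz : Alternate w x z) : w.count x ≤ 2 := by
  wlog hlt : y < z generalizing y z
  · exact this hxz hxy hyz.symm hz hy (by omega)
  by_contra! hcount
  have hsub : [x, x, x] <+ w := List.replicate_sublist_iff.2 hcount
  obtain ⟨s₁, t₁, rfl, hs₁, hsub₂⟩ := List.cons_sublist_iff.1 hsub
  obtain ⟨s₂, t₂, rfl, hs₂, hsub₃⟩ := List.cons_sublist_iff.1 hsub₂
  obtain ⟨p, q, rfl⟩ := List.append_of_mem hs₁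
  obtain ⟨p', q', rfl⟩ := List.append_of_mem hs₂
  obtain ⟨p'', q'', rfl⟩ := List.append_of_mem (List.singleton_sublist.1 hsub₃)
  have key : ∀ v, Alternate (p ++ x :: q ++ (p' ++ x :: q' ++ (p'' ++ x :: q''))) x v →
      v ∈ q ++ p' ∧ v ∈ q' ++ p'' := by
    intro v hv
    refine ⟨Alternate.mem_between (x := x) (p := p) (r := q' ++ (p'' ++ x :: q'')) ?_,
      Alternate.mem_between (x := x) (p := p ++ x :: (q ++ p')) (r := q'') ?_⟩ <;>
    simpa using hv
  have no : ∀ a b c, a < b → b < c → ¬ [a, c, b] <+ _ := fun a b c hab hbc =>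
    hw.not_sublist_s1 (a := a) (b := b) (c := c) hab hbc
  have e : p ++ x :: q ++ (p' ++ x :: q' ++ (p'' ++ x :: q'')) =
      p ++ ([x] ++ ((q ++ p') ++ ([x] ++ ((q' ++ p'') ++ ([x] ++ q''))))) := by simp
  rw [e] at no
  have sub : ∀ u v, u ∈ q ++ p' → v ∈ q' ++ p'' → [x, u, x, v, x] <+
      p ++ ([x] ++ ((q ++ p') ++ ([x] ++ ((q' ++ p'') ++ ([x] ++ q''))))) := by
    intro u v hu hv
    refine List.Sublist.trans ?_ (List.sublist_append_right p _)
    exact (List.Sublist.refl [x]).append <| (List.singleton_sublist.2 hu).append <|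
      (List.Sublist.refl [x]).append <| (List.singleton_sublist.2 hv).append <|
      List.sublist_append_left [x] q''
  obtain ⟨hy₁, hy₂⟩ := key y hy
  obtain ⟨hz₁, hz₂⟩ := key z hz
  rcases lt_or_gt_of_ne hxy with h | h
  · exact no x y z h hlt (List.Sublist.trans
      (show [x, z, y].Sublist [x, z, x, y, x] by simp) (sub z y hz₁ hy₂))
  rcases lt_or_gt_of_ne hxz with h' | h'
  · exact no y x z h h' (List.Sublist.trans
      (show [y, z, x].Sublist [x, y, x, z, x] from
        .cons _ (.cons_cons _ (.cons _ (.refl _)))) (sub y z hy₁ hz₂))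
  · exact no y z x hlt h' (List.Sublist.trans
      (show [y, x, z].Sublist [x, y, x, z, x] from
        .cons _ (.cons_cons _ (.cons_cons _ (.cons_cons _ (List.nil_sublist _)))))
      (sub y z hy₁ hz₂))

/-- If a 132-avoiding word `w` represents a graph `G` in which every vertex has
degree at least 2, then the length of `w` is at most `2 * n`, where `n = |A(w)|`. -/
theorem length_le_two_mul_card (w : List ℕ) (G : SimpleGraph ℕ)
    (hw : Avoids132 w) (hrep : Represents w G)
    (hdeg : ∀ x ∈ w, 2 ≤ (G.neighborSet x).ncard) :
    w.length ≤ 2 * w.toFinset.card := by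
  rw [← List.sum_toFinset_count_eq_length, mul_comm, ← smul_eq_mul]
  refine Finset.sum_le_card_nsmul _ _ _ fun x hx => ?_
  rw [List.mem_toFinset] at hx
  have hcard := hdeg x hx
  obtain ⟨y, z, hy, hz, hyz⟩ :=
    (Set.one_lt_ncard_iff (Set.finite_of_ncard_pos (by omega))).1 hcard
  rw [SimpleGraph.mem_neighborSet] at hy hz
  exact hw.count_le_two hy.ne hz.ne hyz
    ((hrep.2 x y hy.ne hx (hrep.1 y x hy.symm)).1 hy)
    ((hrep.2 x z hz.ne hx (hrep.1 z x hz.symm)).1 hz)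
end

section
/- Let w be a 132-avoiding word representing a finite simple graph G (so the vertex set of G is A(w) and adjacency equals alternation in w). Suppose x is a vertex of G with degree exactly 1, and the unique vertex a adjacent to x has degree at least 2 in G. Then x occurs at most three times in w, i.e., n_w(x) ≤ 3. -/
/-- If a letter `y` alternates with `x`, then it occurs between any two occurrences of `x`. -/
theorem Alternate.exists_between {w : List ℕ} {x y : ℕ} (h : Alternate w x y)
    {i j : ℕ} (hij : i < j) (hj : j < w.length) (hxi : w[i] = x) (hxj : w[j] = x) :
    ∃ (k : ℕ) (hk : k < w.length), i < k ∧ k < j ∧ w[k] = y := by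
  by_contra! hno
  set s := (w.drop i).take (j - i + 1) with hs
  have hinf : s <:+: w := (List.take_prefix _ _).isInfix.trans (List.drop_suffix _ _).isInfix
  have hchain : (s.filter (fun c => decide (c = x ∨ c = y))).IsChain (· ≠ ·) :=
    List.IsChain.infix h (hinf.filter _)
  have hmem : ∀ c ∈ s.filter (fun c => decide (c = x ∨ c = y)), c = x := by
    intro c hc
    obtain ⟨hc, hcxy⟩ := List.mem_filter.1 hc
    obtain ⟨k, hk, rfl⟩ := List.getElem_of_mem hc
    have hlen : k < j - i + 1 := by simp [hs] at hk; omega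
    simp only [hs, List.getElem_take, List.getElem_drop, decide_eq_true_eq] at hcxy ⊢
    rcases hcxy with hc | hc
    · exact hc
    · rcases Nat.eq_zero_or_pos k with rfl | hk0
      · simpa using hxi
      · rcases Nat.lt_or_ge (i + k) j with hlt | hge
        · exact absurd hc (hno _ (by omega) (by omega) hlt)
        · obtain rfl : i + k = j := by omega
          exact hxj
  have htwo : 2 ≤ (s.filter (fun c => decide (c = x ∨ c = y))).length := by
    have hlen : s.length = j - i + 1 := by simp [hs]; omega
    have hsub : (List.map (fun n : Fin s.length => s[n]) [⟨0, by omega⟩, ⟨j - i, by omega⟩]).Sublist s :=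
      List.map_getElem_sublist (by simp; omega)
    have hi : s[0] = x := by simp [hs, hxi]
    have hj : s[j - i] = x := by simp [hs, Nat.add_sub_cancel' hij.le, hxj]
    simpa [hi, hj] using (hsub.filter (fun c => decide (c = x ∨ c = y))).length_le
  match ht : s.filter (fun c => decide (c = x ∨ c = y)) with
  | [] => rw [ht] at htwo; simp at htwo
  | [_] => rw [ht] at htwo; simp at htwo
  | c :: d :: _ =>
    rw [ht] at hchain hmem
    exact (List.isChain_cons_cons.1 hchain).1 ((hmem c (by simp)).trans (hmem d (by simp)).symm)

/-- A 132-avoiding word has no occurrence of the pattern at given positions. -/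
theorem Avoids132.not_lt {w : List ℕ} (hw : Avoids132 w) {i j k : ℕ} (hij : i < j) (hjk : j < k)
    (hk : k < w.length) (hlt : w[i] < w[k]) : ¬ w[k] < w[j] := fun h =>
  hw ⟨i, by omega⟩ ⟨j, by omega⟩ ⟨k, hk⟩ hij hjk ⟨hlt, h⟩

/-- In a 132-avoiding word, if `a` alternates with two distinct letters `x` and `b`,
then `x` occurs at most three times. -/
theorem Avoids132.count_le_three {w : List ℕ} (hw : Avoids132 w) {x a b : ℕ} (hxa : x ≠ a)
    (hab : a ≠ b) (hxb : x ≠ b) (hax : Alternate w x a) (hba : Alternate w a b) :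
    w.count x ≤ 3 := by
  by_contra! hcount
  have hsub : (List.replicate 4 x).Sublist w := List.replicate_sublist_iff.2 hcount
  obtain ⟨f, hf⟩ := List.sublist_iff_exists_fin_orderEmbedding_get_eq.1 hsub
  have hfx : ∀ (n : ℕ) (hn : n < (List.replicate 4 x).length), w[(f ⟨n, hn⟩ : ℕ)] = x := by
    intro n hn
    exact (hf ⟨n, hn⟩).symm.trans (List.eq_of_mem_replicate (List.get_mem _ _))
  have hlt : ∀ (m n : ℕ) (hm : m < n) (hn : n < (List.replicate 4 x).length),
      (f ⟨m, hm.trans hn⟩ : ℕ) < f ⟨n, hn⟩ := fun m n hm hn => f.lt_iff_lt.2 hm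
  obtain ⟨p, hp, hp₁, hp₂, hpa⟩ := hax.exists_between (hlt 0 1 (by simp) (by simp)) (Fin.is_lt _)
    (hfx _ _) (hfx _ _)
  obtain ⟨q, hq, hq₁, hq₂, hqa⟩ := hax.exists_between (hlt 1 2 (by simp) (by simp)) (Fin.is_lt _)
    (hfx _ _) (hfx _ _)
  obtain ⟨r, hr, hr₁, hr₂, hra⟩ := hax.exists_between (hlt 2 3 (by simp) (by simp)) (Fin.is_lt _)
    (hfx _ _) (hfx _ _)
  obtain ⟨s, hs, hs₁, hs₂, hsb⟩ := hba.exists_between (hp₂.trans hq₁) hq hpa hqa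
  obtain ⟨t, ht, ht₁, ht₂, htb⟩ := hba.exists_between (hq₂.trans hr₁) hr hqa hra
  have h₀ := hfx 0 (by simp)
  have h₁ := hfx 1 (by simp)
  have h₂ := hfx 2 (by simp)
  have hxab := hw.not_lt hp₁ hs₁ hs
  have hxba := hw.not_lt (hp₁.trans hs₁) hs₂ hq
  have habx := hw.not_lt hs₁ (hs₂.trans hq₂) (Fin.is_lt _)
  have haxb := hw.not_lt hp₂ (hq₁.trans ht₁) ht
  have hbax := hw.not_lt hs₂ hq₂ (Fin.is_lt _)
  have hbxa := hw.not_lt (hs₂.trans hq₂) hr₁ hr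
  simp only [h₀, h₁, h₂, hpa, hqa, hra, hsb, htb] at hxab hxba habx haxb hbax hbxa
  omega

/-- If a 132-avoiding word `w` represents a graph `G`, `x` is a vertex of degree
exactly 1 in `G`, and the vertex `a` adjacent to `x` has degree at least 2, then
`x` occurs at most three times in `w`. -/
theorem count_le_three_of_degree_one (w : List ℕ) (G : SimpleGraph ℕ)
    (hw : Avoids132 w) (hrep : Represents w G)
    (x a : ℕ) (hx : x ∈ w)
    (hdegx : (G.neighborSet x).ncard = 1) (hadj : G.Adj x a)
    (hdega : 2 ≤ (G.neighborSet a).ncard) :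
    w.count x ≤ 3 := by
  obtain ⟨b, hb, hbx⟩ := Set.exists_ne_of_one_lt_ncard hdega x
  have hba : G.Adj a b := hb
  have ha : a ∈ w := hrep.1 a b hba
  have hbw : b ∈ w := hrep.1 b a hba.symm
  exact hw.count_le_three hadj.ne hba.ne hbx.symm ((hrep.2 x a hadj.ne hx ha).1 hadj)
    ((hrep.2 a b hba.ne ha hbw).1 hba)
end

section
/- If a finite simple graph G is 132-representable, then there exists a 132-avoiding word w representing a finite simple graph isomorphic to G such that every letter x in A(w) satisfies n_w(x) ≤ 2, i.e., every letter occurs at most twice in w. -/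
theorem avoids132_iff_sublist (w : List ℕ) :
    Avoids132 w ↔ ∀ a b c, [a, c, b].Sublist w → a < b → b < c → False := by
  constructor
  · intro h a b c hs hab hbc
    obtain ⟨is, his, hp⟩ := List.sublist_eq_map_getElem hs
    match is, his, hp with
    | [i, j, k], his, hp =>
      simp only [List.map_cons, List.map_nil, List.cons.injEq, and_true] at his
      simp only [List.pairwise_cons, List.mem_cons, List.not_mem_nil, or_false] at hp
      refine h i j k (hp.1 j (Or.inl rfl)) (hp.2.1 k rfl) ?_
      simp only [List.get_eq_getElem]
      obtain ⟨h1, h2, h3⟩ := his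
      simp only [Fin.getElem_fin] at h1 h2 h3
      omega
  · intro h i j k hij hjk ⟨h1, h2⟩
    refine h (w.get i) (w.get k) (w.get j) ?_ h1 h2
    have := List.map_getElem_sublist (l := w) (is := [i, j, k])
      (by simp [hij, hjk, hij.trans hjk])
    simpa using this

theorem pair_sublist_cons {a b d : ℕ} {l : List ℕ} :
    [a, b].Sublist (d :: l) ↔ [a, b].Sublist l ∨ (a = d ∧ b ∈ l) := by
  rw [List.sublist_cons_iff]
  simp

theorem triple_sublist_cons {a b c d : ℕ} {l : List ℕ} :
    [a, b, c].Sublist (d :: l) ↔ [a, b, c].Sublist l ∨ (a = d ∧ [b, c].Sublist l) := by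
  rw [List.sublist_cons_iff]
  grind

theorem pair_sublist_append {a b : ℕ} {l m : List ℕ} :
    [a, b].Sublist (l ++ m) ↔
      [a, b].Sublist l ∨ (a ∈ l ∧ b ∈ m) ∨ [a, b].Sublist m := by
  induction l with
  | nil => simp
  | cons d l ih =>
    simp only [List.cons_append, pair_sublist_cons, ih, List.mem_append, List.mem_cons]
    tauto

theorem triple_sublist_append {a b c : ℕ} {l m : List ℕ} :
    [a, b, c].Sublist (l ++ m) ↔
      [a, b, c].Sublist l ∨ ([a, b].Sublist l ∧ c ∈ m) ∨ (a ∈ l ∧ [b, c].Sublist m) ∨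
        [a, b, c].Sublist m := by
  induction l with
  | nil => simp
  | cons d l ih =>
    simp only [List.cons_append, triple_sublist_cons, pair_sublist_cons, pair_sublist_append,
      ih, List.mem_cons]
    grind

theorem Avoids132.sublist {u w : List ℕ} (hw : Avoids132 w) (h : u.Sublist w) : Avoids132 u := by
  rw [avoids132_iff_sublist] at *
  exact fun a b c hs => hw a b c (hs.trans h)

theorem Avoids132.map {w : List ℕ} (hw : Avoids132 w) {f : ℕ → ℕ} (hf : StrictMono f) :
    Avoids132 (w.map f) := by
  rw [avoids132_iff_sublist] at *
  intro a b c hs hab hbc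
  obtain ⟨l, hl, hm⟩ := List.sublist_map_iff.1 hs
  match l, hl, hm with
  | [a', c', b'], hl, hm =>
    simp only [List.map_cons, List.map_nil, List.cons.injEq, and_true] at hm
    obtain ⟨rfl, rfl, rfl⟩ := hm
    exact hw a' b' c' hl (hf.lt_iff_lt.1 hab) (hf.lt_iff_lt.1 hbc)

theorem Avoids132.cons_of_forall_le {u : List ℕ} {n : ℕ} (hu : Avoids132 u)
    (h : ∀ b ∈ u, b ≤ n + 1) : Avoids132 (n :: u) := by
  rw [avoids132_iff_sublist] at *
  intro a b c hs hab hbc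
  rcases triple_sublist_cons.1 hs with hs | ⟨rfl, hs'⟩
  · exact hu a b c hs hab hbc
  · have := h c (hs'.subset List.mem_cons_self)
    omega

theorem alternate_comm {w : List ℕ} {x y : ℕ} : Alternate w x y ↔ Alternate w y x := by
  simp only [Alternate, or_comm]

theorem alternate_congr {u w : List ℕ} {p q : ℕ → Bool} (h : u.filter q = w.filter p)
    {x y : ℕ} (hx : p x) (hy : p y) (hx' : q x) (hy' : q y) :
    Alternate u x y ↔ Alternate w x y := by
  have key : ∀ (r : ℕ → Bool) (l : List ℕ), r x → r y →
      l.filter (fun c => decide (c = x ∨ c = y)) =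
        (l.filter r).filter (fun c => decide (c = x ∨ c = y)) := by
    intro r l hx hy
    rw [List.filter_filter]
    refine List.filter_congr fun c _ => ?_
    by_cases hc : c = x ∨ c = y
    · rcases hc with rfl | rfl <;> simp [*]
    · simp [hc]
  rw [Alternate, Alternate, key q u hx' hy', key p w hx hy, h]

theorem alternate_map {w : List ℕ} {f : ℕ → ℕ} (hf : Function.Injective f) {x y : ℕ} :
    Alternate (w.map f) (f x) (f y) ↔ Alternate w x y := by
  unfold Alternate
  rw [List.filter_map]
  simp only [Function.comp_def, hf.eq_iff]
  rw [List.Chain', List.Chain', List.isChain_map]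
  simp [hf.eq_iff]

/-- A letter alternating with `x` occurs between any two occurrences of `x`. -/
theorem Alternate.mem_between_s3 {A B C : List ℕ} {x y : ℕ}
    (h : Alternate (A ++ x :: (B ++ x :: C)) x y) (hB : x ∉ B) : y ∈ B := by
  by_contra hy
  have hf : B.filter (fun c => decide (c = x ∨ c = y)) = [] := by
    simp only [List.filter_eq_nil_iff, decide_eq_true_eq]
    grind
  unfold Alternate at h
  rw [List.filter_append, List.filter_cons_of_pos (by simp), List.filter_append, hf,
    List.filter_cons_of_pos (by simp), List.Chain', List.isChain_append] at h
  simp at h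

theorem not_alternate_of_isolated_gap {A B C : List ℕ} {x y : ℕ} (hx : x ∉ B) (hy : y ∉ B) :
    ¬ Alternate (A ++ x :: (B ++ x :: C)) x y :=
  fun h => hy (h.mem_between_s3 hx)

theorem exists_three_occurrences {w : List ℕ} {x : ℕ} (h : 3 ≤ w.count x) :
    ∃ A B C D, w = A ++ x :: (B ++ x :: (C ++ x :: D)) ∧ x ∉ A ∧ x ∉ B ∧ x ∉ C := by
  obtain ⟨A, E, rfl, hA⟩ := List.eq_append_cons_of_mem (List.count_pos_iff.1 (by omega : 0 < w.count x))
  rw [List.count_append, List.count_eq_zero_of_not_mem hA, List.count_cons_self] at h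
  obtain ⟨B, E, rfl, hB⟩ := List.eq_append_cons_of_mem (List.count_pos_iff.1 (by omega : 0 < E.count x))
  rw [List.count_append, List.count_eq_zero_of_not_mem hB, List.count_cons_self] at h
  obtain ⟨C, D, rfl, hC⟩ := List.eq_append_cons_of_mem (List.count_pos_iff.1 (by omega : 0 < E.count x))
  exact ⟨A, B, C, D, rfl, hA, hB, hC⟩

/-- In a 132-avoiding word, a letter with at least three occurrences alternates with at
most one other letter. -/
theorem alternate_unique_of_three_le_count {w : List ℕ} (hw : Avoids132 w) {x y z : ℕ}
    (hx : 3 ≤ w.count x) (hxy : x ≠ y) (hxz : x ≠ z) (hy : Alternate w x y)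
    (hz : Alternate w x z) : y = z := by
  obtain ⟨A, B, C, D, rfl, hA, hB, hC⟩ := exists_three_occurrences hx
  have key : ∀ t, Alternate (A ++ x :: (B ++ x :: (C ++ x :: D))) x t → t ∈ B ∧ t ∈ C := by
    intro t ht
    refine ⟨ht.mem_between_s3 hB, ?_⟩
    have : Alternate ((A ++ x :: B) ++ x :: (C ++ x :: D)) x t := by simpa using ht
    exact this.mem_between_s3 hC
  obtain ⟨hyB, hyC⟩ := key y hy
  obtain ⟨hzB, hzC⟩ := key z hz
  rw [avoids132_iff_sublist] at hw
  have main : ∀ s t, s ∈ B → t ∈ C → s ∈ C → t ∈ B → x ≠ s → x ≠ t → s < t → False := by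
    intro s t hsB htC hsC htB hs ht hst
    have key : ∀ p ∈ B, ∀ q ∈ C,
        [x, p, x, q, x].Sublist (A ++ x :: (B ++ x :: (C ++ x :: D))) := by
      intro p hp q hq
      have h1 : [x].Sublist (x :: D) := by simp
      have h2 : [x, q, x].Sublist (x :: (C ++ x :: D)) :=
        ((List.singleton_sublist.2 hq).append h1).cons_cons x
      exact (((List.singleton_sublist.2 hp).append h2).cons_cons x).trans
        (List.sublist_append_right _ _)
    have hst' := key s hsB t htC
    have hts' := key t htB s hsC
    rcases lt_or_gt_of_ne hs with h1 | h1
    · exact hw x s t ((by simp :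
        [x, t, s].Sublist [x, t, x, s, x]).trans hts') h1 hst
    · rcases lt_or_gt_of_ne ht with h2 | h2
      · exact hw s x t ((by simp :
          [s, t, x].Sublist [x, s, x, t, x]).trans hst') h1 h2
      · exact hw s t x ((by simp :
          [s, x, t].Sublist [x, s, x, t, x]).trans hst') hst h2
  rcases lt_trichotomy y z with h | h | h
  · exact (main y z hyB hzC hyC hzB hxy hxz h).elim
  · exact h
  · exact (main z y hzB hyC hzC hyB hxz hxy h).elim

/-- `f` relabels the letters of `w` injectively as those of `u`, preserving alternation. -/
def Relabels (f : ℕ → ℕ) (w u : List ℕ) : Prop :=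
  Set.InjOn f {a | a ∈ w} ∧ (∀ c, c ∈ u ↔ ∃ a ∈ w, f a = c) ∧
    ∀ a ∈ w, ∀ b ∈ w, a ≠ b → (Alternate w a b ↔ Alternate u (f a) (f b))

theorem Relabels.trans {f g : ℕ → ℕ} {w u v : List ℕ} (h₁ : Relabels f w u)
    (h₂ : Relabels g u v) : Relabels (g ∘ f) w v := by
  obtain ⟨i₁, m₁, a₁⟩ := h₁
  obtain ⟨i₂, m₂, a₂⟩ := h₂
  have hm : ∀ a ∈ w, f a ∈ u := fun a ha => (m₁ _).2 ⟨a, ha, rfl⟩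
  refine ⟨fun a ha b hb hab => i₁ ha hb (i₂ (hm a ha) (hm b hb) hab), fun c => ?_, ?_⟩
  · rw [m₂]
    constructor
    · rintro ⟨b, hb, rfl⟩
      obtain ⟨a, ha, rfl⟩ := (m₁ b).1 hb
      exact ⟨a, ha, rfl⟩
    · rintro ⟨a, ha, rfl⟩
      exact ⟨f a, hm a ha, rfl⟩
  · intro a ha b hb hab
    rw [a₁ a ha b hb hab, a₂ _ (hm a ha) _ (hm b hb) fun h => hab (i₁ ha hb h)]
    rfl

theorem relabels_map {f : ℕ → ℕ} (hf : Function.Injective f) (w : List ℕ) :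
    Relabels f w (w.map f) :=
  ⟨hf.injOn, fun c => by simp, fun _ _ _ _ _ => (alternate_map hf).symm⟩

/-- A relabelling that fixes a subword common to `w` and `u`. -/
theorem relabels_of_filter_eq {w u : List ℕ} {p q : ℕ → Bool} {f : ℕ → ℕ}
    (hfil : u.filter q = w.filter p) (hfix : ∀ a ∈ w, p a → f a = a)
    (hmoved : ∀ a ∈ w, ¬ p a → f a ∈ u ∧ ¬ q (f a))
    (hinj : ∀ a ∈ w, ∀ b ∈ w, ¬ p a → ¬ p b → f a = f b → a = b)
    (hsurj : ∀ c ∈ u, ¬ q c → ∃ a ∈ w, f a = c)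
    (halt : ∀ a ∈ w, ¬ p a → ∀ b ∈ w, a ≠ b → (Alternate w a b ↔ Alternate u (f a) (f b))) :
    Relabels f w u := by
  have hmem : ∀ c, (c ∈ u ∧ q c) ↔ (c ∈ w ∧ p c) := by
    intro c
    rw [← List.mem_filter, ← List.mem_filter, hfil]
  refine ⟨?_, ?_, ?_⟩
  · intro a ha b hb hab
    have := hmem a
    have := hmem b
    have := hfix a ha
    have := hfix b hb
    have := hmoved a ha
    have := hmoved b hb
    by_cases hpa : p a <;> by_cases hpb : p b
    · grind
    · grind
    · grind
    · exact hinj a ha b hb hpa hpb hab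
  · intro c
    constructor
    · intro hc
      by_cases hqc : q c
      · obtain ⟨h1, h2⟩ := (hmem c).1 ⟨hc, hqc⟩
        exact ⟨c, h1, hfix c h1 h2⟩
      · exact hsurj c hc hqc
    · rintro ⟨a, ha, rfl⟩
      by_cases hpa : p a
      · rw [hfix a ha hpa]
        exact ((hmem a).2 ⟨ha, hpa⟩).1
      · exact (hmoved a ha hpa).1
  · intro a ha b hb hab
    by_cases hpa : p a
    · by_cases hpb : p b
      · rw [hfix a ha hpa, hfix b hb hpb]
        exact (alternate_congr hfil hpa hpb ((hmem a).2 ⟨ha, hpa⟩).2 ((hmem b).2 ⟨hb, hpb⟩).2).symm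
      · rw [alternate_comm, halt b hb hpb a ha hab.symm, alternate_comm]
    · exact halt a ha hpa b hb hab

/-- Replacing a letter `x` by a letter `v`, keeping the subword of the other letters. -/
theorem relabels_update {w u : List ℕ} {x v : ℕ} (hx : x ∈ w) (hv : v ∈ u)
    (hfil : u.filter (· ≠ v) = w.filter (· ≠ x))
    (halt : ∀ z ∈ w, z ≠ x → (Alternate w x z ↔ Alternate u v z)) :
    Relabels (fun z => if z = x then v else z) w u := by
  refine relabels_of_filter_eq hfil ?_ ?_ ?_ ?_ ?_
  · grind
  · grind
  · grind
  · intro c hc hcv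
    exact ⟨x, hx, by simp at hcv; simp [hcv]⟩
  · intro a ha hax b hb hab
    obtain rfl : a = x := by simpa using hax
    simpa [hab.symm] using halt b hb hab.symm

theorem length_filter_ne_add_count (w : List ℕ) (x : ℕ) :
    (w.filter (· ≠ x)).length + w.count x = w.length := by
  induction w with
  | nil => rfl
  | cons a w ih => grind

theorem exists_shorter_of_isolated {w : List ℕ} (hw : Avoids132 w) {x : ℕ}
    (hx : 3 ≤ w.count x) (hiso : ∀ y ∈ w, y ≠ x → ¬ Alternate w x y) :
    ∃ f u, Avoids132 u ∧ Relabels f w u ∧ u.length < w.length := by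
  obtain ⟨n, hn⟩ : ∃ n, ∀ a ∈ w, a < n := ⟨w.sum + 1, fun a ha => by
    have := List.le_sum_of_mem ha
    omega⟩
  have hxw : x ∈ w := List.count_pos_iff.1 (by omega)
  refine ⟨_, n :: n :: w.filter (· ≠ x), ?_, relabels_update (v := n) hxw (by simp) ?_ ?_, ?_⟩
  · refine Avoids132.cons_of_forall_le (Avoids132.cons_of_forall_le (hw.sublist List.filter_sublist) ?_) ?_
    all_goals
      simp only [List.mem_cons, List.mem_filter]
      grind
  · simp only [ne_eq, not_true_eq_false, decide_false, Bool.false_eq_true, not_false_eq_true,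
      List.filter_cons_of_neg, List.filter_filter]
    refine List.filter_congr fun c hc => ?_
    have := (hn c hc).ne
    simp [this]
  · intro z hz hzx
    refine iff_of_false (hiso z hz hzx) ?_
    exact not_alternate_of_isolated_gap (A := []) (B := []) (by simp) (by simp)
  · have := length_filter_ne_add_count w x
    simp only [List.length_cons]
    omega

theorem exists_shorter_of_isolated_edge {w : List ℕ} (hw : Avoids132 w) {x y : ℕ} (hxy : x ≠ y)
    (hx : 3 ≤ w.count x) (hy : 3 ≤ w.count y) (halt : Alternate w x y) :
    ∃ f u, Avoids132 u ∧ Relabels f w u ∧ u.length < w.length := by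
  obtain ⟨n, hn⟩ : ∃ n, ∀ a ∈ w, a < n := ⟨w.sum + 1, fun a ha => by
    have := List.le_sum_of_mem ha
    omega⟩
  have hxw : x ∈ w := List.count_pos_iff.1 (by omega)
  have hyw : y ∈ w := List.count_pos_iff.1 (by omega)
  set v := w.filter (fun c => c ≠ x ∧ c ≠ y) with hv
  have hvw : ∀ a ∈ v, a ∈ w := fun a ha => List.mem_of_mem_filter ha
  have hnv : v.filter (fun c => decide (c = n + 1 ∨ c = n)) = [] := by
    rw [List.filter_eq_nil_iff]
    intro c hc
    have := hn c (hvw c hc)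
    grind
  have haltn : Alternate ((n + 1) :: n :: (n + 1) :: n :: v) (n + 1) n := by
    simp only [Bool.decide_or] at hnv
    simp [Alternate, List.Chain', hnv]
  have hno : ∀ b ∈ w, ¬ Alternate ((n + 1) :: n :: (n + 1) :: n :: v) (n + 1) b ∧
      ¬ Alternate ((n + 1) :: n :: (n + 1) :: n :: v) n b := by
    intro b hb
    have := hn b hb
    constructor
    · exact not_alternate_of_isolated_gap (A := []) (B := [n]) (by simp) (by simp; omega)
    · exact not_alternate_of_isolated_gap (A := [n + 1]) (B := [n + 1]) (by simp) (by simp; omega)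
  refine ⟨fun z => if z = x then n + 1 else if z = y then n else z,
    (n + 1) :: n :: (n + 1) :: n :: v, ?_,
    relabels_of_filter_eq (p := fun c => c ≠ x ∧ c ≠ y) (q := fun c => c ≠ n + 1 ∧ c ≠ n)
      ?_ ?_ ?_ ?_ ?_ ?_, ?_⟩
  · have hvn : ∀ a ∈ v, a < n := fun a ha => hn a (hvw a ha)
    refine ((((hw.sublist List.filter_sublist).cons_of_forall_le ?_).cons_of_forall_le
      ?_).cons_of_forall_le ?_).cons_of_forall_le ?_
    all_goals grind
  · rw [← hv]
    simp only [ne_eq, not_true_eq_false, decide_false, and_false, false_and, Bool.false_eq_true,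
      not_false_eq_true, List.filter_cons_of_neg]
    rw [List.filter_eq_self]
    intro c hc
    have := hn c (hvw c hc)
    grind
  · grind
  · grind
  · grind
  · intro c hc hcn
    have : c = n + 1 ∨ c = n := by grind
    rcases this with rfl | rfl
    · exact ⟨x, hxw, by simp⟩
    · exact ⟨y, hyw, by simp [hxy.symm]⟩
  · intro a ha hpa b hb hab
    have : a = x ∨ a = y := by grind
    rcases this with rfl | rfl
    · by_cases hby : b = y
      · subst hby
        simpa [hxy.symm, halt] using haltn
      · simp only [if_true, if_neg hab.symm, if_neg hby]
        exact iff_of_false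
          (fun h => hby (alternate_unique_of_three_le_count hw hx hxy hab halt h).symm) (hno b hb).1
    · by_cases hbx : b = x
      · subst hbx
        simpa [hab, alternate_comm.1 halt] using alternate_comm.1 haltn
      · simp only [if_neg hxy.symm, if_true, if_neg hab.symm, if_neg hbx]
        exact iff_of_false
          (fun h => hbx (alternate_unique_of_three_le_count hw hy hxy.symm hab
            (alternate_comm.1 halt) h).symm) (hno b hb).2
  · have h1 := length_filter_ne_add_count w x
    have h2 := length_filter_ne_add_count (w.filter (· ≠ x)) y
    have h3 : (w.filter (· ≠ x)).count y = w.count y := List.count_filter (by simpa using hxy.symm)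
    have h4 : (w.filter (· ≠ x)).filter (· ≠ y) = v := by
      rw [List.filter_filter, hv]
      exact List.filter_congr fun c _ => by simp [Bool.and_comm]
    rw [h4] at h2
    simp only [List.length_cons]
    omega

/-- A letter with one neighbour `y`, which occurs twice, can be made to occur only on both
sides of the first `y`. -/
theorem relabels_surround {w P Q : List ℕ} {x y v : ℕ} (hx : x ∈ w)
    (hfil : w.filter (· ≠ x) = P ++ y :: Q) (hyP : y ∉ P) (hyQ : Q.count y = 1)
    (hvP : v ∉ P) (hvQ : v ∉ Q) (hvy : v ≠ y) (halt : Alternate w x y)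
    (huniq : ∀ z ∈ w, z ≠ x → Alternate w x z → z = y) :
    Relabels (fun z => if z = x then v else z) w (P ++ v :: y :: v :: Q) := by
  have hself : ∀ l : List ℕ, v ∉ l → l.filter (· ≠ v) = l := by
    intro l hl
    rw [List.filter_eq_self]
    grind
  refine relabels_update hx (by simp) ?_ ?_
  · rw [hfil, List.filter_append, hself P hvP]
    simpa [hvy.symm] using hself Q hvQ
  · intro z hz hzx
    by_cases hzy : z = y
    · subst hzy
      refine iff_of_true halt ?_
      have h1 : P.filter (fun c => decide (c = v ∨ c = z)) = [] := by
        rw [List.filter_eq_nil_iff]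
        grind
      have h2 : Q.filter (fun c => decide (c = v ∨ c = z)) = [z] := by
        have : Q.filter (fun c => decide (c = v ∨ c = z)) = Q.filter (· == z) :=
          List.filter_congr fun c hc => by grind
        rw [this, List.filter_beq, hyQ]
        rfl
      unfold Alternate
      rw [List.filter_append, h1]
      simp only [Bool.decide_or] at h2
      simp [h2, List.Chain', hvy, hvy.symm]
    · refine iff_of_false (fun h => hzy (huniq z hz hzx h)) ?_
      exact not_alternate_of_isolated_gap (B := [y]) (by simpa using hvy) (by simpa using hzy)

/-- A letter occurring at least three times which alternates with a letter occurring at most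
twice occurs exactly three times. -/
theorem exists_decomposition_of_pendant {w : List ℕ} {x y : ℕ} (hxy : x ≠ y)
    (hx : 3 ≤ w.count x) (hy : w.count y ≤ 2) (halt : Alternate w x y) :
    ∃ A B₁ B₂ C₁ C₂ D,
      w = A ++ x :: (B₁ ++ y :: (B₂ ++ x :: (C₁ ++ y :: (C₂ ++ x :: D)))) ∧
      ∀ l ∈ [A, B₁, B₂, C₁, C₂, D], x ∉ l ∧ y ∉ l := by
  obtain ⟨A, B, C, D, rfl, hA, hB, hC⟩ := exists_three_occurrences hx
  have hyB : y ∈ B := halt.mem_between_s3 hB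
  have hyC : y ∈ C := Alternate.mem_between_s3 (A := A ++ x :: B) (C := D) (by simpa using halt) hC
  have hxD : y ∉ D → x ∉ D := by
    intro hyD hxD
    obtain ⟨D₁, D₂, rfl, hD⟩ := List.eq_append_cons_of_mem hxD
    have : y ∈ D₁ := Alternate.mem_between_s3 (A := A ++ x :: (B ++ x :: C)) (C := D₂)
      (by simpa using halt) hD
    exact hyD (by simp [this])
  obtain ⟨B₁, B₂, rfl, hB₁⟩ := List.eq_append_cons_of_mem hyB
  obtain ⟨C₁, C₂, rfl, hC₁⟩ := List.eq_append_cons_of_mem hyC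
  simp only [List.count_append, List.count_cons_self, List.count_cons_of_ne hxy] at hy
  have h0 : ∀ l : List ℕ, l.count y = 0 → y ∉ l := fun l => List.count_eq_zero.1
  have hyD := h0 D (by omega)
  refine ⟨A, B₁, B₂, C₁, C₂, D, by simp, ?_⟩
  simp only [List.mem_append, List.mem_cons, not_or] at hB hC
  simp only [List.mem_cons, List.not_mem_nil, or_false, forall_eq_or_imp, forall_eq]
  exact ⟨⟨hA, h0 A (by omega)⟩, ⟨hB.1, hB₁⟩, ⟨hB.2.2, h0 B₂ (by omega)⟩, ⟨hC.1, hC₁⟩,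
    ⟨hC.2.2, h0 C₂ (by omega)⟩, hxD hyD, hyD⟩

/-- Surrounding a letter `y` that is minimal up to its first occurrence by copies of `y + 1`
preserves 132-avoidance. -/
theorem Avoids132.surround_succ {P Q : List ℕ} {y : ℕ} (h : Avoids132 (P ++ y :: Q))
    (hP : ∀ a ∈ P, y < a) (hvP : y + 1 ∉ P) (hvQ : y + 1 ∉ Q) :
    Avoids132 (P ++ (y + 1) :: y :: (y + 1) :: Q) := by
  rw [avoids132_iff_sublist] at *
  intro a b c hs hab hbc
  have key := h (if a = y + 1 then y else a) (if b = y + 1 then y else b)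
    (if c = y + 1 then y else c)
  have hyP : y ∉ P := fun h => lt_irrefl _ (hP y h)
  simp only [triple_sublist_append, triple_sublist_cons, pair_sublist_cons,
    List.mem_cons] at hs key
  have mem : ∀ {s t : ℕ} {l : List ℕ}, [s, t].Sublist l → s ∈ l ∧ t ∈ l :=
    fun h => ⟨h.subset (by simp), h.subset (by simp)⟩
  grind

/-- Surrounding a letter `y` by copies of a letter smaller than all the preceding letters. -/
theorem Avoids132.surround_of_lt {P Q : List ℕ} {x y : ℕ} (h : Avoids132 (P ++ y :: Q))
    (hP : ∀ a ∈ P, x < a) (hy : x < y) (h' : Avoids132 (x :: y :: Q)) :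
    Avoids132 (P ++ x :: y :: x :: Q) := by
  rw [avoids132_iff_sublist] at *
  intro a b c hs hab hbc
  have hxP : x ∉ P := fun h => lt_irrefl _ (hP x h)
  have key := h a b c
  have key' := h' a b c
  simp only [triple_sublist_append, triple_sublist_cons, pair_sublist_cons,
    List.mem_cons] at hs key key'
  have mem : ∀ {s t : ℕ} {l : List ℕ}, [s, t].Sublist l → s ∈ l ∧ t ∈ l :=
    fun h => ⟨h.subset (by simp), h.subset (by simp)⟩
  grind

theorem exists_shorter_of_pendant {w : List ℕ} (hw : Avoids132 w) {x y : ℕ} (hxy : x ≠ y)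
    (hx : 3 ≤ w.count x) (hy : w.count y ≤ 2) (halt : Alternate w x y) (hy1 : y + 1 ∉ w) :
    ∃ f u, Avoids132 u ∧ Relabels f w u ∧ u.length < w.length := by
  have huniq : ∀ z ∈ w, z ≠ x → Alternate w x z → z = y := fun z _ hzx hz =>
    alternate_unique_of_three_le_count hw hx hzx.symm hxy hz halt
  have hxw : x ∈ w := List.count_pos_iff.1 (by omega)
  have hlen := length_filter_ne_add_count w x
  have hsub : Avoids132 (w.filter (· ≠ x)) := hw.sublist List.filter_sublist
  obtain ⟨A, B₁, B₂, C₁, C₂, D, hdec, hmem⟩ := exists_decomposition_of_pendant hxy hx hy halt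
  simp only [List.mem_cons, List.not_mem_nil, or_false, forall_eq_or_imp, forall_eq] at hmem
  obtain ⟨⟨hxA, hyA⟩, ⟨hxB₁, hyB₁⟩, ⟨hxB₂, hyB₂⟩, ⟨hxC₁, hyC₁⟩, ⟨hxC₂, hyC₂⟩, hxD, hyD⟩ := hmem
  have hself : ∀ l : List ℕ, x ∉ l → l.filter (· ≠ x) = l := by
    intro l hl
    rw [List.filter_eq_self]
    grind
  set P := A ++ B₁ with hP
  set Q := B₂ ++ (C₁ ++ y :: (C₂ ++ D)) with hQ
  have hfil : w.filter (· ≠ x) = P ++ y :: Q := by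
    have e : ∀ l : List ℕ, (x :: l).filter (· ≠ x) = l.filter (· ≠ x) := by simp
    have e' : ∀ l : List ℕ, (y :: l).filter (· ≠ x) = y :: l.filter (· ≠ x) := by
      simp [hxy.symm]
    rw [hdec]
    simp only [List.filter_append, e, e', hself _ hxA, hself _ hxB₁, hself _ hxB₂, hself _ hxC₁,
      hself _ hxC₂, hself _ hxD]
    simp [hP, hQ]
  have hyP : y ∉ P := by simp [hP, hyA, hyB₁]
  have hyQ : Q.count y = 1 := by
    simp [hQ, List.count_eq_zero_of_not_mem, hyB₂, hyC₁, hyC₂, hyD]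
  have hmemPQ : ∀ a, a ∈ P ++ y :: Q → a ∈ w ∧ a ≠ x := by
    intro a ha
    rw [← hfil] at ha
    simpa using ha
  have hlen' : ∀ v, (P ++ v :: y :: v :: Q).length < w.length := by
    intro v
    rw [hfil] at hlen
    simp only [List.length_append, List.length_cons] at hlen ⊢
    omega
  have hpat := (avoids132_iff_sublist w).1 hw
  rw [hfil] at hsub
  rcases lt_or_gt_of_ne hxy with hlt | hlt
  · refine ⟨_, P ++ x :: y :: x :: Q, hsub.surround_of_lt ?_ hlt ?_,
      relabels_surround hxw hfil hyP hyQ (fun h => (hmemPQ x (by simp [h])).2 rfl)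
        (fun h => (hmemPQ x (by simp [h])).2 rfl) hxy halt huniq, hlen' x⟩
    · intro a ha
      refine lt_of_le_of_ne (le_of_not_gt fun hax => ?_) (hmemPQ a (by simp [ha])).2.symm
      refine hpat a x y ?_ hax hlt
      rw [hdec]
      simp only [hP, List.mem_append] at ha
      simp only [triple_sublist_append, triple_sublist_cons, pair_sublist_append,
        pair_sublist_cons, List.mem_append, List.mem_cons]
      grind
    · refine hw.sublist ?_
      rw [hdec, hQ]
      refine .trans (.cons_cons x ?_) (List.sublist_append_right _ _)
      refine .trans (.cons_cons y ?_) (List.sublist_append_right _ _)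
      refine .append (.refl _) (.cons x (.append (.refl _) (.cons_cons y (.append (.refl _) ?_))))
      exact List.sublist_cons_self x D
  · refine ⟨_, P ++ (y + 1) :: y :: (y + 1) :: Q, hsub.surround_succ ?_ ?_ ?_,
      relabels_surround hxw hfil hyP hyQ ?_ ?_ (by simp) halt huniq, hlen' (y + 1)⟩
    · intro a ha
      refine lt_of_le_of_ne (le_of_not_gt fun hay => ?_) fun h => hyP (h ▸ ha)
      refine hpat a y x ?_ hay hlt
      rw [hdec]
      simp only [hP, List.mem_append] at ha
      simp only [triple_sublist_append, triple_sublist_cons, pair_sublist_append,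
        pair_sublist_cons, List.mem_append, List.mem_cons]
      grind
    all_goals exact fun h => hy1 (hmemPQ (y + 1) (by simp [h])).1

theorem exists_shorter_of_three_le_count {w : List ℕ} (hw : Avoids132 w) {x : ℕ}
    (hx : 3 ≤ w.count x) :
    ∃ f u, Avoids132 u ∧ Relabels f w u ∧ u.length < w.length := by
  have hmono : StrictMono fun a : ℕ => 2 * a := fun a b h => by
    simp only
    omega
  by_cases hiso : ∀ y ∈ w, y ≠ x → ¬ Alternate w x y
  · exact exists_shorter_of_isolated hw hx hiso
  push Not at hiso
  obtain ⟨y, hyw, hyx, halt⟩ := hiso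
  rcases le_or_gt (w.count y) 2 with hy | hy
  · have hc := fun a => List.count_map_of_injective w (fun a : ℕ => 2 * a) hmono.injective a
    obtain ⟨f, u, hu, hr, hl⟩ := exists_shorter_of_pendant (hw.map hmono) (x := 2 * x) (y := 2 * y)
      (by omega) ((hc x).symm ▸ hx) ((hc y).symm ▸ hy) ((alternate_map hmono.injective).2 halt)
      (by simp only [List.mem_map, not_exists, not_and]; omega)
    exact ⟨_, u, hu, (relabels_map hmono.injective w).trans hr, by simpa using hl⟩
  · exact exists_shorter_of_isolated_edge hw hyx.symm hx hy halt

theorem exists_relabels_count_le_two {w : List ℕ} (hw : Avoids132 w) :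
    ∃ f u, Avoids132 u ∧ Relabels f w u ∧ ∀ x, u.count x ≤ 2 := by
  induction h : w.length using Nat.strong_induction_on generalizing w with
  | _ n ih =>
    by_cases hc : ∀ x, w.count x ≤ 2
    · refine ⟨id, w, hw, ?_, hc⟩
      simpa using relabels_map Function.injective_id w
    · push Not at hc
      obtain ⟨x, hx⟩ := hc
      obtain ⟨f, u, hu, hr, hl⟩ := exists_shorter_of_three_le_count hw hx
      obtain ⟨g, v, hv, hr', hcv⟩ := ih u.length (h ▸ hl) hu rfl
      exact ⟨g ∘ f, v, hv, hr.trans hr', hcv⟩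

/-- The graph on the letters of `w` whose edges are the alternating pairs. -/
def alternationGraph (w : List ℕ) : SimpleGraph ℕ where
  Adj a b := a ≠ b ∧ a ∈ w ∧ b ∈ w ∧ Alternate w a b
  symm := ⟨fun _ _ ⟨h, ha, hb, hab⟩ => ⟨h.symm, hb, ha, alternate_comm.1 hab⟩⟩
  loopless := ⟨fun _ h => h.1 rfl⟩

theorem represents_alternationGraph (w : List ℕ) : Represents w (alternationGraph w) :=
  ⟨fun _ _ h => h.2.1, fun _ _ hxy hx hy => ⟨fun h => h.2.2.2, fun h => ⟨hxy, hx, hy, h⟩⟩⟩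

theorem Relabels.nonempty_iso {f : ℕ → ℕ} {w u : List ℕ} (h : Relabels f w u)
    {H : SimpleGraph ℕ} (hH : Represents w H) :
    Nonempty (H.induce (↑w.toFinset : Set ℕ) ≃g
      (alternationGraph u).induce (↑u.toFinset : Set ℕ)) := by
  obtain ⟨hinj, hmem, halt⟩ := h
  have hbij : Set.BijOn f (↑w.toFinset : Set ℕ) (↑u.toFinset : Set ℕ) := by
    refine ⟨fun a ha => ?_, fun a ha b hb => hinj (by simpa using ha) (by simpa using hb),
      fun c hc => ?_⟩
    · simp only [List.coe_toFinset, Set.mem_ofPred_eq] at ha ⊢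
      exact (hmem _).2 ⟨a, ha, rfl⟩
    · simp only [List.coe_toFinset, Set.mem_ofPred_eq] at hc
      simpa using (hmem c).1 hc
  refine ⟨⟨hbij.equiv f, ?_⟩⟩
  rintro ⟨a, ha⟩ ⟨b, hb⟩
  simp only [List.coe_toFinset, Set.mem_ofPred_eq] at ha hb
  change (alternationGraph u).Adj (f a) (f b) ↔ H.Adj a b
  by_cases hab : a = b
  · subst hab
    simp
  · rw [hH.2 a b hab ha hb, halt a ha b hb hab]
    exact ⟨fun h => h.2.2.2, fun h => ⟨fun e => hab (hinj ha hb e), (hmem _).2 ⟨a, ha, rfl⟩,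
      (hmem _).2 ⟨b, hb, rfl⟩, h⟩⟩

/-- If a finite simple graph `G` is 132-representable, then there is a 132-avoiding
word `w` representing a graph isomorphic to `G` in which every letter occurs at
most twice. -/
theorem exists_representant_count_le_two {V : Type*} [Fintype V] (G : SimpleGraph V)
    (h : Representable132 G) :
    ∃ (w : List ℕ) (H : SimpleGraph ℕ), Avoids132 w ∧ Represents w H ∧
      Nonempty (G ≃g H.induce (↑w.toFinset : Set ℕ)) ∧
      ∀ x ∈ w, w.count x ≤ 2 := by
  obtain ⟨w, H, hw, hH, ⟨e⟩⟩ := h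
  obtain ⟨f, u, hu, hr, hc⟩ := exists_relabels_count_le_two hw
  obtain ⟨e'⟩ := hr.nonempty_iso hH
  exact ⟨u, alternationGraph u, hu, represents_alternationGraph u, ⟨e.trans e'⟩, fun x _ => hc x⟩
end

section
/- Every finite tree (a finite connected acyclic simple graph) is 132-representable. -/
/-- No three letters of `w` at increasing positions form the pattern 132. -/
def Sublist132Free (w : List ℕ) : Prop :=
  ∀ a b c : ℕ, [a, b, c].Sublist w → ¬ (a < c ∧ c < b)

/-- The first occurrences of the letters of `w` appear in decreasing order. -/
def FirstOccDecreasing (w : List ℕ) : Prop :=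
  ∀ a ∈ w, ∀ b ∈ w, a < b → w.idxOf b < w.idxOf a

theorem Sublist132Free.avoids132 {w : List ℕ} (h : Sublist132Free w) : Avoids132 w := by
  intro i j k hij hjk
  refine h _ _ _ ?_
  have := List.map_getElem_sublist (l := w) (is := [i, j, k])
    (by simp [hij, hjk, hij.trans hjk])
  simpa using this

/-- The word obtained from `A ++ u :: B` by doubling all letters and surrounding the displayed
occurrence of `u` by two copies of a new letter. -/
def insertLeaf (A : List ℕ) (u : ℕ) (B : List ℕ) : List ℕ :=
  A.map (2 * ·) ++ (2 * u + 1) :: (2 * u) :: (2 * u + 1) :: B.map (2 * ·)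

theorem mem_insertLeaf {A B : List ℕ} {u m : ℕ} :
    m ∈ insertLeaf A u B ↔ m = 2 * u + 1 ∨ ∃ x ∈ A ++ u :: B, m = 2 * x := by
  simp only [insertLeaf, List.mem_append, List.mem_map, List.mem_cons]
  grind

theorem map_half_insertLeaf (A : List ℕ) (u : ℕ) (B : List ℕ) :
    (insertLeaf A u B).map (· / 2) = A ++ u :: u :: u :: B := by
  have h : ∀ l : List ℕ, (l.map (2 * ·)).map (· / 2) = l := fun l => by
    simp [Function.comp_def]
  rw [insertLeaf, List.map_append, h]
  simp only [List.map_cons, h]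
  simp
  omega

theorem sublist_of_sublist_cons_cons {u : ℕ} {A B l : List ℕ} (hl : l.IsChain (· ≠ ·))
    (h : l.Sublist (A ++ u :: u :: B)) : l.Sublist (A ++ u :: B) := by
  induction A generalizing l with
  | nil =>
    rcases l with _ | ⟨x, _ | ⟨y, l⟩⟩
    · simp
    · simpa using h
    · simp only [List.nil_append, List.cons_sublist_cons'] at h ⊢
      simp only [List.isChain_cons_cons] at hl
      grind only
  | cons c A ih =>
    rcases l with _ | ⟨x, l⟩
    · simp
    · simp only [List.cons_append, List.cons_sublist_cons'] at h ⊢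
      exact h.imp (ih hl) fun ⟨e, h⟩ => ⟨e, ih hl.tail h⟩

theorem FirstOccDecreasing.lt_of_mem {A B : List ℕ} {u a : ℕ}
    (h : FirstOccDecreasing (A ++ u :: B)) (hu : u ∉ A) (ha : a ∈ A) : u < a := by
  by_contra hlt
  have hne : a ≠ u := fun e => hu (e ▸ ha)
  have := h a (by simp [ha]) u (by simp) (by omega)
  rw [List.idxOf_append, List.idxOf_append, if_neg hu, if_pos ha] at this
  have := List.idxOf_lt_length_of_mem ha
  omega

theorem Sublist132Free.insertLeaf {A B : List ℕ} {u : ℕ} (hu : u ∉ A)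
    (h : Sublist132Free (A ++ u :: B)) (hd : FirstOccDecreasing (A ++ u :: B)) :
    Sublist132Free (insertLeaf A u B) := by
  rintro a b c hs ⟨hac, hcb⟩
  have hhalf := hs.map (· / 2)
  rw [map_half_insertLeaf] at hhalf
  by_cases h1 : a / 2 < c / 2
  · by_cases h2 : c / 2 < b / 2
    · refine h _ _ _ (sublist_of_sublist_cons_cons ?_ (sublist_of_sublist_cons_cons ?_ hhalf))
        ⟨h1, h2⟩
      all_goals simp; omega
    · have hmem : ∀ x ∈ [a, b, c], x % 2 = 1 → x = 2 * u + 1 := by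
        intro x hx
        have := mem_insertLeaf.1 (hs.subset hx)
        grind only
      have hb := hmem b (by simp) (by omega)
      have hc : c = 2 * u := by omega
      subst hb hc
      have : a / 2 ∈ A := by
        rw [_root_.insertLeaf, List.sublist_append_iff] at hs
        obtain ⟨l₁, l₂, e, s₁, s₂⟩ := hs
        rcases l₁ with _ | ⟨x, l₁⟩
        · rw [List.nil_append] at e
          subst e
          simp only [List.cons_sublist_cons'] at s₂
          have hB : 2 * u + 1 ∉ B.map (2 * ·) := by
            simp
            omega
          rcases s₂ with (((h | h) | h) | h)
          · exact absurd (h.subset (by simp)) hB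
          all_goals omega
        · obtain rfl : a = x := (List.cons.inj e).1
          obtain ⟨y, hy, rfl⟩ := List.mem_map.1 (s₁.subset List.mem_cons_self)
          simpa using hy
      have := hd.lt_of_mem hu this
      omega
  · have hmem : ∀ x ∈ [a, b, c], x % 2 = 1 → x = 2 * u + 1 := by
      intro x hx
      have := mem_insertLeaf.1 (hs.subset hx)
      grind only
    have hc := hmem c (by simp) (by omega)
    have ha : a = 2 * u := by omega
    subst ha hc
    rw [_root_.insertLeaf, List.sublist_append_iff] at hs
    obtain ⟨l₁, l₂, e, s₁, s₂⟩ := hs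
    rcases l₁ with _ | ⟨x, l₁⟩
    · rw [List.nil_append] at e
      subst e
      have hB : 2 * u + 1 ∉ B.map (2 * ·) := by
        simp
        omega
      have hsub : [b, 2 * u + 1].Sublist ((2 * u + 1) :: B.map (2 * ·)) := by
        rcases List.cons_sublist_cons'.1 s₂ with h | h
        · rcases List.cons_sublist_cons'.1 h with h | h
          · exact (List.sublist_cons_self _ _).trans h
          · exact h.2
        · omega
      rcases List.cons_sublist_cons'.1 hsub with h | h
      · exact hB (h.subset (by simp))
      · omega
    · obtain rfl : 2 * u = x := (List.cons.inj e).1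
      obtain ⟨y, hy, hyu⟩ := List.mem_map.1 (s₁.subset List.mem_cons_self)
      exact hu (by rwa [show u = y by omega])

theorem FirstOccDecreasing.insertLeaf {A B : List ℕ} {u : ℕ} (hu : u ∉ A)
    (hd : FirstOccDecreasing (A ++ u :: B)) :
    FirstOccDecreasing (insertLeaf A u B) := by
  have hmap : ∀ (l : List ℕ) (x : ℕ), (l.map (2 * ·)).idxOf (2 * x) = l.idxOf x := by
    intro l x
    induction l with
    | nil => simp
    | cons y l ih => grind
  have hlt := fun a => hd.lt_of_mem (a := a) hu
  have hlen : ∀ x ∈ A, A.idxOf x < A.length := fun x => List.idxOf_lt_length_of_mem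
  have hodd : (_root_.insertLeaf A u B).idxOf (2 * u + 1) = A.length := by
    have : 2 * u + 1 ∉ A.map (2 * ·) := by
      simp
      omega
    simp [_root_.insertLeaf, List.idxOf_append, this]
  have heven : ∀ x, (_root_.insertLeaf A u B).idxOf (2 * x) =
      if x ∈ A then A.idxOf x else if x = u then A.length + 1
        else A.length + 3 + B.idxOf x := by
    intro x
    have hA : 2 * x ∈ A.map (2 * ·) ↔ x ∈ A := by simp
    have hne : 2 * u + 1 ≠ 2 * x := by omega
    simp only [_root_.insertLeaf, List.idxOf_append, hA, hmap, List.idxOf_cons_ne _ hne]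
    by_cases hx : x = u
    · subst hx
      simp [hu]
      omega
    · rw [List.idxOf_cons_ne _ (by omega), List.idxOf_cons_ne _ hne, hmap]
      simp only [hx, if_false, List.length_map]
      split <;> omega
  have hidx : ∀ x, (A ++ u :: B).idxOf x =
      if x ∈ A then A.idxOf x else if x = u then A.length
        else A.length + 1 + B.idxOf x := by
    intro x
    grind
  have hmem := fun a => (mem_insertLeaf (A := A) (B := B) (u := u) (m := a)).1
  intro a ha b hb hab
  rcases hmem a ha with rfl | ⟨x, hx, rfl⟩ <;> rcases hmem b hb with rfl | ⟨y, hy, rfl⟩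
  · omega
  · have := hd u (by simp) y hy (by omega)
    rw [hidx, hidx] at this
    rw [hodd, heven]
    grind
  · by_cases hxu : x = u
    · rw [hodd, heven]
      grind
    · have := hd x hx u (by simp) (by omega)
      rw [hidx, hidx] at this
      rw [hodd, heven]
      grind
  · have := hd x hx y hy (by omega)
    rw [hidx, hidx] at this
    rw [heven, heven]
    split_ifs at this ⊢ with hxA hyA <;>
      first
      | omega
      | have := hlen x (by assumption)
        omega

theorem count_insertLeaf_le {A B : List ℕ} {u : ℕ}
    (h : ∀ n, (A ++ u :: B).count n ≤ 2) (n : ℕ) : (insertLeaf A u B).count n ≤ 2 := by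
  have hinj : Function.Injective (2 * · : ℕ → ℕ) := fun a b h => by simpa using h
  have hodd : ∀ (l : List ℕ) (x : ℕ), (l.map (2 * ·)).count (2 * x + 1) = 0 := by
    intro l x
    rw [List.count_eq_zero]
    simp
    omega
  rcases Nat.even_or_odd' n with ⟨x, rfl | rfl⟩
  · have hA := List.count_map_of_injective A (2 * ·) hinj x
    have hB := List.count_map_of_injective B (2 * ·) hinj x
    have := h x
    simp only [insertLeaf, List.count_append, List.count_cons] at this ⊢
    grind
  · simp only [insertLeaf, List.count_append, List.count_cons, hodd]
    grind

theorem alternate_insertLeaf_two_mul {A B : List ℕ} {u x y : ℕ} :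
    Alternate (insertLeaf A u B) (2 * x) (2 * y) ↔ Alternate (A ++ u :: B) x y := by
  have : (insertLeaf A u B).filter (fun c => decide (c = 2 * x ∨ c = 2 * y)) =
      ((A ++ u :: B).filter (fun c => decide (c = x ∨ c = y))).map (2 * ·) := by
    have h1 : ¬ (2 * u + 1 = 2 * x ∨ 2 * u + 1 = 2 * y) := by omega
    simp [insertLeaf, List.filter_cons, List.filter_map, Function.comp_def, h1]
    split <;> simp
  change List.IsChain _ _ ↔ List.IsChain _ _
  rw [this, List.isChain_map]
  simp

theorem alternate_insertLeaf_new {A B : List ℕ} {u y : ℕ} (hu : u ∉ A)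
    (h : ∀ n, (A ++ u :: B).count n ≤ 2) :
    Alternate (insertLeaf A u B) (2 * u + 1) (2 * y) ↔ y = u := by
  have key : (insertLeaf A u B).filter (fun c => decide (c = 2 * u + 1 ∨ c = 2 * y)) =
      (A.filter (· = y)).map (2 * ·) ++ (2 * u + 1) ::
        ((if y = u then [2 * u] else []) ++ (2 * u + 1) :: (B.filter (· = y)).map (2 * ·)) := by
    simp [insertLeaf, List.filter_cons, List.filter_map, Function.comp_def]
    grind
  change List.IsChain _ _ ↔ _
  rw [key]
  constructor
  · intro hc
    by_contra hne
    simp [hne, List.isChain_append_cons_cons] at hc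
  · rintro rfl
    have hA : A.filter (· = y) = [] := by
      simp only [List.filter_eq_nil_iff]
      grind
    have hB : B.filter (· = y) = List.replicate (B.count y) y := by
      convert List.filter_beq y (l := B) using 2
      ext x
      simp only [beq_eq_decide]
    have := h y
    have hle : B.count y ≤ 1 := by
      simp at this
      omega
    rw [hA, hB]
    interval_cases hk : B.count y <;> simp

/-- A finite tree has a 132-avoiding representant in which first occurrences decrease
and every letter occurs at most twice. -/
theorem exists_word_of_isTree (n : ℕ) : ∀ {V : Type*} [Fintype V] (T : SimpleGraph V),
    T.IsTree → Fintype.card V = n → ∃ (w : List ℕ) (f : V → ℕ), Function.Injective f ∧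
      (∀ m, m ∈ w ↔ ∃ v, f v = m) ∧
      (∀ x y, x ≠ y → (T.Adj x y ↔ Alternate w (f x) (f y))) ∧
      Sublist132Free w ∧ FirstOccDecreasing w ∧ ∀ m, w.count m ≤ 2 := by
  classical
  induction n with
  | zero =>
    intro V _ T hT hn
    have := hT.1.nonempty
    exact absurd hn Fintype.card_ne_zero
  | succ n ih =>
    intro V _ T hT hn
    rcases subsingleton_or_nontrivial V with hV | hV
    · obtain ⟨v⟩ := hT.1.nonempty
      refine ⟨[0], fun _ => 0, fun _ _ _ => Subsingleton.elim _ _, ?_, ?_, ?_, ?_, ?_⟩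
      · intro m
        simp [eq_comm, hT.1.nonempty]
      · intro x y hxy
        exact absurd (Subsingleton.elim x y) hxy
      · intro a b c h
        simpa using h.length_le
      · intro a ha b hb hab
        simp_all
      · intro m
        exact List.count_le_length.trans (by simp)
    · obtain ⟨v, hv⟩ := hT.exists_vert_degree_one_of_nontrivial
      have hT' : (T.induce {v}ᶜ).IsTree :=
        ⟨hT.1.induce_compl_singleton_of_degree_eq_one hv, hT.2.induce _⟩
      have hcard : Fintype.card ({v}ᶜ : Set V) = n := by
        rw [Fintype.card_compl_set]
        simp [hn]
      obtain ⟨w, f, hf, hw, hadj, havoid, hdec, hcount⟩ := ih (T.induce {v}ᶜ) hT' hcard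
      obtain ⟨p, hp, hpu⟩ := SimpleGraph.degree_eq_one_iff_existsUnique_adj.mp hv
      have hpv : p ∈ ({v}ᶜ : Set V) := by simpa using hp.ne'
      obtain ⟨u, hu⟩ : ∃ u, u = f ⟨p, hpv⟩ := ⟨_, rfl⟩
      obtain ⟨A, B, rfl, huA⟩ := List.eq_append_cons_of_mem ((hw u).2 ⟨_, hu.symm⟩)
      let g : V → ℕ := fun x => if h : x = v then 2 * u + 1 else 2 * f ⟨x, h⟩
      have gv : g v = 2 * u + 1 := by simp [g]
      have gne : ∀ x (h : x ≠ v), g x = 2 * f ⟨x, h⟩ := fun x h => by simp [g, h]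
      have hnew : ∀ x (h : x ≠ v),
          T.Adj v x ↔ Alternate (insertLeaf A u B) (g v) (g x) := by
        intro x h
        rw [gv, gne x h, alternate_insertLeaf_new huA hcount, hu, hf.eq_iff]
        exact ⟨fun e => Subtype.ext (hpu x e),
          fun e => by rwa [show x = p from congrArg Subtype.val e]⟩
      refine ⟨insertLeaf A u B, g, ?_, ?_, ?_, havoid.insertLeaf huA hdec, hdec.insertLeaf huA,
        count_insertLeaf_le hcount⟩
      · intro x y hxy
        by_cases hx : x = v <;> by_cases hy : y = v
        · rw [hx, hy]
        · subst hx
          rw [gv, gne y hy] at hxy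
          omega
        · subst hy
          rw [gv, gne x hx] at hxy
          omega
        · rw [gne x hx, gne y hy] at hxy
          have := hf (Nat.eq_of_mul_eq_mul_left two_pos hxy)
          exact congrArg Subtype.val this
      · intro m
        rw [mem_insertLeaf]
        constructor
        · rintro (rfl | ⟨x, hx, rfl⟩)
          · exact ⟨v, gv⟩
          · obtain ⟨⟨y, hy⟩, rfl⟩ := (hw x).1 hx
            exact ⟨y, gne y hy⟩
        · rintro ⟨y, rfl⟩
          by_cases hy : y = v
          · exact Or.inl (hy ▸ gv)
          · exact Or.inr ⟨_, (hw _).2 ⟨⟨y, hy⟩, rfl⟩, gne y hy⟩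
      · intro x y hxy
        by_cases hx : x = v
        · subst hx
          exact hnew y hxy.symm
        · by_cases hy : y = v
          · subst hy
            rw [T.adj_comm, alternate_comm]
            exact hnew x hx
          · rw [gne x hx, gne y hy, alternate_insertLeaf_two_mul,
              ← hadj _ _ fun e => hxy (congrArg Subtype.val e)]
            simp

/-- Every finite tree (finite connected acyclic simple graph) is 132-representable. -/
theorem tree_representable132 {V : Type*} [Fintype V] (T : SimpleGraph V)
    (hT : T.IsTree) : Representable132 T := by
  obtain ⟨w, f, hf, hw, hadj, havoid, -, -⟩ := exists_word_of_isTree _ T hT rfl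
  refine ⟨w, T.map (⟨f, hf⟩ : V ↪ ℕ), havoid.avoids132, ⟨?_, ?_⟩, ⟨?_⟩⟩
  · rintro _ _ h
    obtain ⟨a, b, -, rfl, rfl⟩ := (SimpleGraph.map_adj _ _ _ _).1 h
    exact (hw _).2 ⟨a, rfl⟩
  · intro x y hxy hx hy
    obtain ⟨a, rfl⟩ := (hw x).1 hx
    obtain ⟨b, rfl⟩ := (hw y).1 hy
    rw [← hadj a b (fun e => hxy (e ▸ rfl))]
    exact SimpleGraph.map_adj_apply (f := ⟨f, hf⟩)
  · have hrange : Set.range f = (↑w.toFinset : Set ℕ) := by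
      ext m
      simp [hw]
    refine ⟨(Equiv.ofInjective f hf).trans (Equiv.setCongr hrange), ?_⟩
    intro a b
    exact SimpleGraph.map_adj_apply (f := ⟨f, hf⟩)
end

section
/- For every finite tree T and every choice of a vertex r of T (the root), there exist a 132-avoiding word w and a finite simple graph G represented by w together with a graph isomorphism f from T to G, such that the letter f(r) occurs exactly once in w and every other letter of A(w) occurs exactly twice in w. -/
section WordsOverATree

variable {V : Type*}

/-- Generic form of `Alternate`, for words over an arbitrary alphabet. -/
def AlternatesIn [DecidableEq V] (w : List V) (x y : V) : Prop :=
  (w.filter (fun c => decide (c = x ∨ c = y))).IsChain (· ≠ ·)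

/-- The word `w` avoids 132 when its letters are compared through the labelling `f`. -/
def Avoids132Via (f : V → ℕ) (w : List V) : Prop :=
  ∀ a b c, [a, b, c].Sublist w → ¬ (f a < f c ∧ f c < f b)

/-- The word `w`, labelled by `f`, is a 132-avoiding representant of the connected component
of `r` in `G`, in which `r` is the smallest letter and occurs once, and all other letters
occur twice. -/
structure IsRootedRepresentant [DecidableEq V] (G : SimpleGraph V) (r : V) (w : List V)
    (f : V → ℕ) : Prop where
  mem_iff : ∀ v, v ∈ w ↔ G.Reachable r v
  injOn : ∀ x ∈ w, ∀ y ∈ w, f x = f y → x = y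
  avoids : Avoids132Via f w
  count_root : w.count r = 1
  count_of_ne : ∀ x ∈ w, x ≠ r → w.count x = 2
  root_le : ∀ x ∈ w, f r ≤ f x
  adj_iff : ∀ x ∈ w, ∀ y ∈ w, x ≠ y → (G.Adj x y ↔ AlternatesIn w x y)

lemma Avoids132Via.avoids132_map {f : V → ℕ} {w : List V} (h : Avoids132Via f w) :
    Avoids132 (w.map f) := by
  have key : ∀ i j k (hij : i < j) (hjk : j < k) (hk : k < w.length),
      [w[i], w[j], w[k]].Sublist w := by
    intro i j k hij hjk hk
    have := List.map_getElem_sublist (l := w)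
      (is := [⟨i, by omega⟩, ⟨j, by omega⟩, ⟨k, hk⟩]) (by simp; omega)
    simpa using this
  intro i j k hij hjk
  have hk : (k : ℕ) < w.length := by simpa using k.2
  have := h _ _ _ (key i j k hij hjk hk)
  simpa using this

lemma Avoids132Via.join {w₁ w₂ : List V} {c : V} {f : V → ℕ} (h₁ : Avoids132Via f w₁)
    (h₂ : Avoids132Via f w₂) (hlt : ∀ x ∈ w₁, ∀ y ∈ w₂, f y < f x) (hc : c ∈ w₁)
    (hmin : ∀ x ∈ w₁, f c ≤ f x) : Avoids132Via f (w₁ ++ (w₂ ++ [c])) := by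
  rintro a b d hs ⟨had, hdb⟩
  obtain ⟨l₁, l', he, s₁, s'⟩ := List.sublist_append_iff.mp hs
  obtain ⟨l₂, l₃, rfl, s₂, s₃⟩ := List.sublist_append_iff.mp s'
  have m₂ := s₂.subset
  rcases l₁ with _ | ⟨a', l₁⟩
  · rcases List.sublist_singleton.mp s₃ with rfl | rfl
    · rw [List.nil_append, List.append_nil] at he
      exact h₂ a b d (he ▸ s₂) ⟨had, hdb⟩
    · obtain ⟨rfl, hd⟩ : [a, b] = l₂ ∧ [d] = [c] := List.append_inj' (s₁ := [a, b]) he rfl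
      obtain rfl : d = c := by simpa using hd
      exact (hdb.trans (hlt d hc b (m₂ (by simp)))).false
  · obtain ⟨rfl, -⟩ : a = a' ∧ _ := by simpa using he
    have ha : a ∈ w₁ := s₁.subset (by simp)
    rcases List.sublist_singleton.mp s₃ with rfl | rfl
    · rcases List.eq_nil_or_concat l₂ with rfl | ⟨l, d', rfl⟩
      · rw [List.append_nil, List.append_nil] at he
        exact h₁ a b d (he ▸ s₁) ⟨had, hdb⟩
      · obtain rfl : d = d' := by
          simpa [List.getLast?_cons] using congrArg List.getLast? he
        exact (had.trans (hlt a ha d (m₂ (by simp)))).false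
    · obtain rfl : d = c := by
        simpa [List.getLast?_cons] using congrArg List.getLast? he
      exact (had.trans_le (hmin a ha)).false

variable [DecidableEq V]

lemma AlternatesIn.symm {w : List V} {x y : V} (h : AlternatesIn w x y) :
    AlternatesIn w y x := by
  unfold AlternatesIn at *
  simpa only [or_comm] using h

lemma alternate_map_iff {f : V → ℕ} {w : List V} {x y : V}
    (hx : ∀ v ∈ w, f v = f x → v = x) (hy : ∀ v ∈ w, f v = f y → v = y) :
    Alternate (w.map f) (f x) (f y) ↔ AlternatesIn w x y := by
  have hfil : (w.map f).filter (fun c => decide (c = f x ∨ c = f y)) =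
      (w.filter (fun c => decide (c = x ∨ c = y))).map f := by
    rw [List.filter_map]
    congr 1
    refine List.filter_congr fun v hv => ?_
    simp only [Function.comp, decide_eq_decide]
    exact ⟨fun h => h.imp (hx v hv) (hy v hv), fun h => h.imp (congrArg f) (congrArg f)⟩
  change List.IsChain _ _ ↔ _
  rw [hfil, List.isChain_map]
  unfold AlternatesIn
  have hmem : ∀ v ∈ w.filter (fun c => decide (c = x ∨ c = y)), v ∈ w ∧ (v = x ∨ v = y) := by
    intro v hv
    simpa using hv
  refine ⟨fun h => h.imp fun a b hab => ?_, fun h => ?_⟩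
  · exact fun e => hab (congrArg f e)
  · refine List.IsChain.imp_of_mem_imp (fun a b ha hb hab e => hab ?_) h
    obtain ⟨haw, -⟩ := hmem a ha
    obtain ⟨-, rfl | rfl⟩ := hmem b hb
    · exact hx a haw e
    · exact hy a haw e

lemma filter_or_eq_replicate {w : List V} {x y : V} (h : y ∉ w) :
    w.filter (fun c => decide (c = x ∨ c = y)) = List.replicate (w.count x) x := by
  rw [← List.filter_eq]
  refine List.filter_congr fun v hv => ?_
  have : v ≠ y := fun e => h (e ▸ hv)
  simp [this, eq_comm]

lemma filter_or_eq_nil {w : List V} {x y : V} (hx : x ∉ w) (hy : y ∉ w) :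
    w.filter (fun c => decide (c = x ∨ c = y)) = [] := by
  rw [filter_or_eq_replicate hy, List.count_eq_zero_of_not_mem hx, List.replicate_zero]

lemma isChain_ne_append_singleton_iff {l : List V} {c y : V} (hcy : c ≠ y)
    (hl : ∀ v ∈ l, v = c ∨ v = y) (hc : l.count c = 1) (hy : l.count y = 2) :
    (l ++ [c]).IsChain (· ≠ ·) ↔ l.IsChain (· ≠ ·) := by
  have hlen : l.length = 3 := by
    have h1 := List.length_eq_countP_add_countP (fun v => v == c) (l := l)
    have h2 : l.countP (fun v => decide ¬ (v == c) = true) = l.count y := by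
      refine List.countP_congr fun v hv => ?_
      rcases hl v hv with rfl | rfl <;> simp [hcy, hcy.symm]
    have h3 : l.countP (fun v => v == c) = l.count c := rfl
    omega
  obtain ⟨a, b, d, rfl⟩ := List.length_eq_three.mp hlen
  have ha := hl a (by simp)
  have hb := hl b (by simp)
  have hd := hl d (by simp)
  rcases ha with rfl | rfl <;> rcases hb with rfl | rfl <;> rcases hd with rfl | rfl <;>
    simp_all [hcy.symm]

lemma alternatesIn_append_singleton_iff {w : List V} {c y : V} (hcy : c ≠ y)
    (hc : w.count c = 1) (hy : w.count y = 2) :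
    AlternatesIn (w ++ [c]) c y ↔ AlternatesIn w c y := by
  unfold AlternatesIn
  rw [List.filter_append]
  have : [c].filter (fun v => decide (v = c ∨ v = y)) = [c] := by simp
  rw [this]
  refine isChain_ne_append_singleton_iff hcy (fun v hv => by simpa using (List.mem_filter.mp hv).2)
    ?_ ?_
  · rw [List.count_filter (by simp), hc]
  · rw [List.count_filter (by simp), hy]

section Join

variable {w₁ w₂ : List V} {c : V}

lemma alternatesIn_join_iff_right {x y : V} (hx : x ∉ w₁) (hy : y ∉ w₁) (hxc : x ≠ c)
    (hyc : y ≠ c) : AlternatesIn (w₁ ++ (w₂ ++ [c])) x y ↔ AlternatesIn w₂ x y := by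
  unfold AlternatesIn
  rw [List.filter_append, List.filter_append, filter_or_eq_nil hx hy,
    filter_or_eq_nil (w := [c]) (by simpa using hxc) (by simpa using hyc)]
  simp

lemma alternatesIn_join_iff_left {x y : V} (hx : x ∉ w₂) (hy : y ∉ w₂) :
    AlternatesIn (w₁ ++ (w₂ ++ [c])) x y ↔ AlternatesIn (w₁ ++ [c]) x y := by
  unfold AlternatesIn
  rw [List.filter_append, List.filter_append, List.filter_append, filter_or_eq_nil hx hy]
  simp

lemma alternatesIn_append_iff_of_not_mem {w u : List V} {x y : V} (hx : x ∉ u) (hy : y ∉ u) :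
    AlternatesIn (w ++ u) x y ↔ AlternatesIn w x y := by
  unfold AlternatesIn
  rw [List.filter_append, filter_or_eq_nil hx hy, List.append_nil]

lemma not_alternatesIn_append_of_count_eq_two {w u : List V} {x y : V} (hy : y ∉ w)
    (hx : w.count x = 2) : ¬ AlternatesIn (w ++ u) x y := by
  unfold AlternatesIn
  rw [List.filter_append, filter_or_eq_replicate hy, hx]
  simp [List.replicate]

lemma alternatesIn_join_iff_count {y : V} (hc : w₁.count c = 1) (hcw : c ∉ w₂)
    (hy : y ∉ w₁) (hyc : y ≠ c) (hyw : y ∈ w₂) (hy2 : w₂.count y ≤ 2) :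
    AlternatesIn (w₁ ++ (w₂ ++ [c])) c y ↔ w₂.count y = 1 := by
  have h2 : w₂.filter (fun v => decide (v = c ∨ v = y)) = List.replicate (w₂.count y) y := by
    rw [← filter_or_eq_replicate hcw]
    simp only [or_comm]
  have h3 : [c].filter (fun v => decide (v = c ∨ v = y)) = [c] := by simp
  unfold AlternatesIn
  rw [List.filter_append, List.filter_append, filter_or_eq_replicate hy, hc, h2, h3]
  have hpos := List.count_pos_iff.mpr hyw
  obtain h | h : w₂.count y = 1 ∨ w₂.count y = 2 := by omega
  · simp [h, List.replicate, hyc, hyc.symm]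
  · simp [h, List.replicate]

end Join

lemma SimpleGraph.adj_iff_deleteEdges_singleton {G : SimpleGraph V} {r c : V} (h : G.Adj r c)
    (x y : V) : G.Adj x y ↔ (G.deleteEdges {s(r, c)}).Adj x y ∨ s(x, y) = s(r, c) := by
  simp only [SimpleGraph.deleteEdges_adj, Set.mem_singleton_iff]
  constructor
  · intro hxy
    by_cases he : s(x, y) = s(r, c) <;> simp [he, hxy]
  · rintro (hxy | he)
    · exact hxy.1
    · rwa [← SimpleGraph.mem_edgeSet, he]

lemma SimpleGraph.reachable_iff_deleteEdges_singleton {G : SimpleGraph V} {r c : V}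
    (h : G.Adj r c) (v : V) : G.Reachable r v ↔
      (G.deleteEdges {s(r, c)}).Reachable r v ∨ (G.deleteEdges {s(r, c)}).Reachable c v := by
  have hle := G.deleteEdges_le {s(r, c)}
  constructor
  · rw [SimpleGraph.reachable_iff_reflTransGen]
    intro hv
    induction hv with
    | refl => exact Or.inl (SimpleGraph.Reachable.refl _)
    | tail _ hadj ih =>
      rcases (SimpleGraph.adj_iff_deleteEdges_singleton h _ _).mp hadj with hadj | he
      · exact ih.imp (·.trans hadj.reachable) (·.trans hadj.reachable)
      · rcases Sym2.eq_iff.mp he with ⟨-, rfl⟩ | ⟨-, rfl⟩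
        · exact Or.inr (SimpleGraph.Reachable.refl _)
        · exact Or.inl (SimpleGraph.Reachable.refl _)
  · rintro (hv | hv)
    · exact hv.mono hle
    · exact h.reachable.trans (hv.mono hle)

lemma isRootedRepresentant_singleton {G : SimpleGraph V} {r : V} (h : ∀ c, ¬ G.Adj r c) :
    IsRootedRepresentant G r [r] (fun _ => 0) where
  mem_iff v := by
    rw [List.mem_singleton, SimpleGraph.reachable_iff_reflTransGen]
    constructor
    · rintro rfl
      exact .refl
    · intro hv
      rcases Relation.ReflTransGen.cases_head hv with rfl | ⟨c, hc, -⟩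
      · rfl
      · exact (h c hc).elim
  injOn := by simp
  avoids a b d hs := by simp
  count_root := by simp
  count_of_ne := by simp
  root_le := by simp
  adj_iff := by simp +contextual

lemma IsRootedRepresentant.congr {G : SimpleGraph V} {r : V} {w : List V} {f g : V → ℕ}
    (h : IsRootedRepresentant G r w f)
    (hg : ∀ x ∈ w, ∀ y ∈ w, g x < g y ↔ f x < f y) : IsRootedRepresentant G r w g where
  mem_iff := h.mem_iff
  injOn x hx y hy e := by
    refine h.injOn x hx y hy ?_
    have := hg x hx y hy
    have := hg y hy x hx
    omega
  avoids a b d hs := by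
    have ha : a ∈ w := hs.subset (by simp)
    have hb : b ∈ w := hs.subset (by simp)
    have hd : d ∈ w := hs.subset (by simp)
    rw [hg a ha d hd, hg d hd b hb]
    exact h.avoids a b d hs
  count_root := h.count_root
  count_of_ne := h.count_of_ne
  root_le x hx := by
    have hr : r ∈ w := List.count_pos_iff.mp (by rw [h.count_root]; exact one_pos)
    exact not_lt.mp fun hlt => (h.root_le x hx).not_gt ((hg x hx r hr).mp hlt)
  adj_iff := h.adj_iff

lemma IsRootedRepresentant.root_mem {G : SimpleGraph V} {r : V} {w : List V} {f : V → ℕ}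
    (h : IsRootedRepresentant G r w f) : r ∈ w :=
  (h.mem_iff r).mpr (SimpleGraph.Reachable.refl _)

lemma IsRootedRepresentant.join {G : SimpleGraph V} {r c : V} {w₁ w₂ : List V} {f : V → ℕ}
    (hrc : G.Adj r c)
    (h₁ : IsRootedRepresentant (G.deleteEdges {s(r, c)}) c w₁ f)
    (h₂ : IsRootedRepresentant (G.deleteEdges {s(r, c)}) r w₂ f)
    (hlt : ∀ x ∈ w₁, ∀ y ∈ w₂, f y < f x) :
    IsRootedRepresentant G r (w₁ ++ (w₂ ++ [c])) f := by
  have hc₁ := h₁.root_mem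
  have hr₂ := h₂.root_mem
  have disj : ∀ x ∈ w₁, x ∉ w₂ := fun x hx hx' => (hlt x hx x hx').false
  have hmem : ∀ v, v ∈ w₁ ++ (w₂ ++ [c]) ↔ v ∈ w₁ ∨ v ∈ w₂ := by
    intro v
    simp only [List.mem_append, List.mem_singleton]
    grind
  have hcross : ∀ x ∈ w₁, ∀ y ∈ w₂,
      (G.Adj x y ↔ AlternatesIn (w₁ ++ (w₂ ++ [c])) x y) := by
    intro x hx y hy
    have hyw₁ : y ∉ w₁ := fun h => disj y h hy
    have hnadj : ¬ (G.deleteEdges {s(r, c)}).Adj x y := fun h =>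
      hyw₁ ((h₁.mem_iff y).mpr (((h₁.mem_iff x).mp hx).trans h.reachable))
    have hxr : x ≠ r := fun h => disj x hx (h ▸ hr₂)
    rw [SimpleGraph.adj_iff_deleteEdges_singleton hrc, or_iff_right hnadj]
    by_cases hxc : x = c
    · subst hxc
      have hcnt : w₂.count y = 1 ↔ y = r := by
        by_cases hyr : y = r
        · simp [hyr, h₂.count_root]
        · simp [hyr, h₂.count_of_ne y hy hyr]
      have hle : w₂.count y ≤ 2 := by
        by_cases hyr : y = r
        · simp [hyr, h₂.count_root]
        · simp [h₂.count_of_ne y hy hyr]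
      rw [alternatesIn_join_iff_count h₁.count_root (disj x hx) hyw₁
        (fun h => hyw₁ (h ▸ hx)) hy hle, hcnt, Sym2.eq_iff]
      grind
    · refine iff_of_false ?_
        (not_alternatesIn_append_of_count_eq_two hyw₁ (h₁.count_of_ne x hx hxc))
      rw [Sym2.eq_iff]
      grind
  refine ⟨?_, ?_, ?_, ?_, ?_, ?_, ?_⟩
  · intro v
    rw [hmem, h₁.mem_iff, h₂.mem_iff, SimpleGraph.reachable_iff_deleteEdges_singleton hrc, or_comm]
  · intro x hx y hy e
    rcases (hmem x).mp hx with hx | hx <;> rcases (hmem y).mp hy with hy | hy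
    · exact h₁.injOn x hx y hy e
    · exact absurd e (hlt x hx y hy).ne'
    · exact absurd e (hlt y hy x hx).ne
    · exact h₂.injOn x hx y hy e
  · exact h₁.avoids.join h₂.avoids hlt hc₁ h₁.root_le
  · have : r ∉ w₁ := fun h => disj r h hr₂
    simp [List.count_eq_zero_of_not_mem this, h₂.count_root, hrc.ne.symm]
  · intro x hx hxr
    rcases (hmem x).mp hx with hx | hx
    · have h0 := List.count_eq_zero_of_not_mem (disj x hx)
      by_cases hxc : x = c
      · subst hxc
        simp [h0, h₁.count_root]
      · simp [h0, h₁.count_of_ne x hx hxc, Ne.symm hxc]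
    · have hxw₁ : x ∉ w₁ := fun h => disj x h hx
      have hxc : c ≠ x := fun h => hxw₁ (h ▸ hc₁)
      simp [List.count_eq_zero_of_not_mem hxw₁, h₂.count_of_ne x hx hxr, hxc]
  · intro x hx
    rcases (hmem x).mp hx with hx | hx
    · exact (hlt x hx r hr₂).le
    · exact h₂.root_le x hx
  · intro x hxw y hyw hxy
    rcases (hmem x).mp hxw with hx | hx <;> rcases (hmem y).mp hyw with hy | hy
    · have hr₁ : r ∉ w₁ := fun h => disj r h hr₂
      have hne : s(x, y) ≠ s(r, c) := by
        rw [Ne, Sym2.eq_iff]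
        grind
      rw [SimpleGraph.adj_iff_deleteEdges_singleton hrc, or_iff_left hne,
        h₁.adj_iff x hx y hy hxy, alternatesIn_join_iff_left (disj x hx) (disj y hy)]
      have hcase : ∀ z ∈ w₁, c ≠ z → (AlternatesIn w₁ c z ↔ AlternatesIn (w₁ ++ [c]) c z) :=
        fun z hz hcz => (alternatesIn_append_singleton_iff hcz h₁.count_root
          (h₁.count_of_ne z hz hcz.symm)).symm
      by_cases hxc : x = c
      · subst hxc
        exact hcase y hy hxy
      by_cases hyc : y = c
      · subst hyc
        have := hcase x hx hxy.symm
        exact ⟨fun h => (this.mp h.symm).symm, fun h => (this.mpr h.symm).symm⟩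
      · exact (alternatesIn_append_iff_of_not_mem (by simpa using hxc) (by simpa using hyc)).symm
    · exact hcross x hx y hy
    · rw [G.adj_comm, hcross y hy x hx]
      exact ⟨AlternatesIn.symm, AlternatesIn.symm⟩
    · have hc₂ := disj c hc₁
      have hne : s(x, y) ≠ s(r, c) := by
        rw [Ne, Sym2.eq_iff]
        grind
      rw [SimpleGraph.adj_iff_deleteEdges_singleton hrc, or_iff_left hne,
        h₂.adj_iff x hx y hy hxy,
        alternatesIn_join_iff_right (fun h => disj x h hx) (fun h => disj y h hy)
          (ne_of_mem_of_not_mem hx hc₂) (ne_of_mem_of_not_mem hy hc₂)]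

theorem SimpleGraph.IsAcyclic.exists_isRootedRepresentant [Finite V] {G : SimpleGraph V}
    (hG : G.IsAcyclic) (r : V) : ∃ w f, IsRootedRepresentant G r w f := by
  induction G using WellFoundedLT.induction generalizing r with
  | ind G ih =>
  by_cases h : ∃ c, G.Adj r c
  · obtain ⟨c, hrc⟩ := h
    set G' := G.deleteEdges {s(r, c)} with hG'
    have hle : G' ≤ G := G.deleteEdges_le _
    have hlt : G' < G := lt_of_le_of_ne hle fun e => by
      have : ¬ G'.Adj r c := by simp [hG']
      exact this (e ▸ hrc)
    have hbr : ¬ G'.Reachable r c :=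
      SimpleGraph.isBridge_iff.mp (SimpleGraph.isAcyclic_iff_forall_adj_isBridge.mp hG hrc)
    obtain ⟨w₁, f₁, h₁⟩ := ih G' hlt (hG.anti hle) c
    obtain ⟨w₂, f₂, h₂⟩ := ih G' hlt (hG.anti hle) r
    obtain ⟨N, hN⟩ := (Set.finite_range f₂).bddAbove
    have hN : ∀ v, f₂ v ≤ N := fun v => hN ⟨v, rfl⟩
    have disj : ∀ x ∈ w₁, x ∉ w₂ := fun x hx hx' =>
      hbr (((h₂.mem_iff x).mp hx').trans ((h₁.mem_iff x).mp hx).symm)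
    refine ⟨w₁ ++ (w₂ ++ [c]), fun v => if v ∈ w₁ then f₁ v + N + 1 else f₂ v,
      IsRootedRepresentant.join hrc (h₁.congr ?_) (h₂.congr ?_) ?_⟩
    · intro x hx y hy
      simp only [hx, hy, if_true]
      omega
    · intro x hx y hy
      have hx' : x ∉ w₁ := fun h => disj x h hx
      have hy' : y ∉ w₁ := fun h => disj y h hy
      simp [hx', hy']
    · intro x hx y hy
      have hy' : y ∉ w₁ := fun h => disj y h hy
      have := hN y
      simp only [hx, hy', if_true, if_false]
      omega
  · exact ⟨_, _, isRootedRepresentant_singleton (not_exists.mp h)⟩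

end WordsOverATree

/-- For every finite tree `T` with a chosen root `r` there are a 132-avoiding word
`w`, a graph `H` represented by `w`, and an isomorphism `f` from `T` to the graph
represented by `w`, such that the letter `f r` occurs exactly once in `w` and every
other letter occurs exactly twice. -/
theorem tree_rooted_representant {V : Type*} [Fintype V] (T : SimpleGraph V)
    (hT : T.IsTree) (r : V) :
    ∃ (w : List ℕ) (H : SimpleGraph ℕ)
      (f : T ≃g H.induce (↑w.toFinset : Set ℕ)),
      Avoids132 w ∧ Represents w H ∧
      w.count (f r : ℕ) = 1 ∧
      ∀ x ∈ w, x ≠ (f r : ℕ) → w.count x = 2 := by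
  classical
  obtain ⟨w, f, h⟩ := hT.isAcyclic.exists_isRootedRepresentant r
  have hw : ∀ v, v ∈ w := fun v => (h.mem_iff v).mpr (hT.connected.preconnected r v)
  have hf : Function.Injective f := fun x y e => h.injOn x (hw x) y (hw y) e
  let e : V ↪ ℕ := ⟨f, hf⟩
  have hmem : ∀ v, f v ∈ (↑(w.map f).toFinset : Set ℕ) := fun v => by simp [hf.eq_iff, hw]
  let g : V ≃ (↑(w.map f).toFinset : Set ℕ) :=
    Equiv.ofBijective (fun v => ⟨f v, hmem v⟩)
      ⟨fun x y e => hf (congrArg Subtype.val e), fun ⟨n, hn⟩ => by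
        obtain ⟨v, -, rfl⟩ : ∃ v ∈ w, f v = n := by simpa using hn
        exact ⟨v, rfl⟩⟩
  refine ⟨w.map f, T.map e, ⟨g, fun {x y} => T.map_adj_apply (f := e)⟩,
    h.avoids.avoids132_map, ⟨?_, ?_⟩, ?_, ?_⟩
  · rintro _ _ ⟨-, x, y, -, rfl, rfl⟩
    exact List.mem_map_of_mem (hw x)
  · intro _ _ hxy hx hy
    obtain ⟨x, -, rfl⟩ := List.mem_map.mp hx
    obtain ⟨y, -, rfl⟩ := List.mem_map.mp hy
    rw [alternate_map_iff (fun v _ e => hf e) (fun v _ e => hf e),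
      ← h.adj_iff x (hw x) y (hw y) (fun e => hxy (congrArg f e))]
    exact T.map_adj_apply (f := e)
  · exact (List.count_map_of_injective w f hf r).trans h.count_root
  · intro _ hx hxr
    obtain ⟨x, -, rfl⟩ := List.mem_map.mp hx
    rw [List.count_map_of_injective w f hf]
    exact h.count_of_ne x (hw x) fun e => hxr (congrArg f e)
end

section
/- For n ≥ 2, let w be the word n, (n−1), n, (n−2), (n−1), (n−3), (n−2), …, 3, 4, 2, 3, 1, 2; formally, w is the letter n followed by the concatenation, for k = n down to 2, of the two-letter factor (k−1)k. Then w is 132-avoiding and w represents the path graph P_n on vertex set {1, 2, …, n} whose edges are exactly the pairs {i, i+1} for 1 ≤ i ≤ n−1. -/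
/-- The path graph `P n` on vertex set `{1, …, n}`, whose edges are exactly the
pairs `{i, i+1}` for `1 ≤ i ≤ n - 1` (all other vertices of `ℕ` are isolated). -/
def pathGraphOn (n : ℕ) : SimpleGraph ℕ :=
  SimpleGraph.fromRel (fun x y => 1 ≤ x ∧ x ≤ n - 1 ∧ y = x + 1)

/-- The word `n (n-1) n (n-2) (n-1) (n-3) (n-2) ⋯ 3 4 2 3 1 2`: the letter `n`
followed by the factors `(k-1) k` for `k = n` down to `2`. -/
def pathWord (n : ℕ) : List ℕ :=
  n :: (List.range (n - 1)).flatMap (fun j => [n - 1 - j, n - j])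

/-- The word `m (m+1) (m-1) m ⋯ 2 3 1 2`. -/
def descendingPairs : ℕ → List ℕ
  | 0 => []
  | m + 1 => (m + 1) :: (m + 2) :: descendingPairs m

theorem flatMap_range_eq_descendingPairs (m : ℕ) :
    (List.range m).flatMap (fun j => [m - j, m + 1 - j]) = descendingPairs m := by
  induction m with
  | zero => rfl
  | succ m ih =>
    rw [List.range_succ_eq_map, List.flatMap_cons, List.flatMap_map, descendingPairs, ← ih]
    simp

theorem pathWord_succ (m : ℕ) : pathWord (m + 1) = (m + 1) :: descendingPairs m := by
  rw [← flatMap_range_eq_descendingPairs]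
  rfl

theorem mem_descendingPairs {m c : ℕ} :
    c ∈ descendingPairs m ↔ 1 ≤ c ∧ c ≤ m + 1 ∧ 1 ≤ m := by
  induction m with
  | zero => simp [descendingPairs]
  | succ m ih =>
    simp only [descendingPairs, List.mem_cons, ih]
    omega

theorem pairwise_descendingPairs (m : ℕ) :
    (descendingPairs m).Pairwise (fun a b => b ≤ a + 1) := by
  induction m with
  | zero => exact List.Pairwise.nil
  | succ m ih =>
    simp only [descendingPairs, List.pairwise_cons, List.mem_cons, mem_descendingPairs]
    refine ⟨fun b hb => ?_, fun b hb => ?_, ih⟩ <;> omega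

theorem mem_pathWord {n c : ℕ} (hn : 2 ≤ n) : c ∈ pathWord n ↔ 1 ≤ c ∧ c ≤ n := by
  obtain ⟨m, rfl⟩ := Nat.exists_eq_add_of_le' hn
  rw [pathWord_succ, List.mem_cons, mem_descendingPairs]
  omega

theorem pairwise_pathWord (m : ℕ) :
    (pathWord (m + 1)).Pairwise (fun a b => b ≤ a + 1) := by
  rw [pathWord_succ, List.pairwise_cons]
  refine ⟨fun b hb => ?_, pairwise_descendingPairs m⟩
  rw [mem_descendingPairs] at hb
  omega

/-- A word in which no letter is followed, at any distance, by a letter exceeding it by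
more than one avoids the pattern 132. -/
theorem avoids132_of_pairwise {w : List ℕ} (h : w.Pairwise (fun a b => b ≤ a + 1)) :
    Avoids132 w := by
  rintro i j k hij hjk ⟨hik, hkj⟩
  have := List.pairwise_iff_get.mp h i j hij
  omega

theorem alternate_iff_isChain {w : List ℕ} {x y : ℕ} :
    Alternate w x y ↔ (w.filter (fun c => decide (c = x ∨ c = y))).IsChain (· ≠ ·) :=
  Iff.rfl

/-- Letters larger than `y` do not affect the restriction of a path word to `{x, y}`. -/
theorem filter_pathWord {x y n : ℕ} (hxy : x < y) (hn : y ≤ n) :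
    (pathWord n).filter (fun c => decide (c = x ∨ c = y)) =
      (pathWord y).filter (fun c => decide (c = x ∨ c = y)) := by
  induction n, hn using Nat.le_induction with
  | base => rfl
  | succ n hn ih =>
    obtain ⟨m, rfl⟩ := Nat.exists_eq_add_of_le' (show 1 ≤ n by omega)
    have h : ¬ (m + 2 = x ∨ m + 2 = y) := by omega
    rw [← ih, pathWord_succ, pathWord_succ, descendingPairs,
      List.filter_cons_of_neg (by simpa using h),
      List.filter_cons, List.filter_cons_of_neg (by simpa using h), List.filter_cons]

theorem alternate_pathWord_iff {x y n : ℕ} (hx : 1 ≤ x) (hxy : x < y) (hn : y ≤ n) :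
    Alternate (pathWord n) x y ↔ y = x + 1 := by
  rw [alternate_iff_isChain, filter_pathWord hxy hn]
  obtain ⟨m, rfl⟩ := Nat.exists_eq_add_of_le' (show 2 ≤ y by omega)
  rw [pathWord_succ, descendingPairs]
  by_cases h : x = m + 1
  · subst h
    cases m with
    | zero => simp [descendingPairs]
    | succ k =>
      have hk : (descendingPairs k).filter
          (fun c => decide (c = k + 1 + 1 ∨ c = k + 1 + 2)) = [] := by
        rw [List.filter_eq_nil_iff]
        intro c hc
        rw [mem_descendingPairs] at hc
        simp only [decide_eq_true_eq]
        omega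
      simp [descendingPairs, hk, -Bool.decide_or]
  · have h1 : ¬ (m + 1 = x ∨ m + 1 = m + 2) := by omega
    rw [List.filter_cons_of_pos (by simp), List.filter_cons_of_neg (by simpa using h1),
      List.filter_cons_of_pos (by simp)]
    simp
    omega

theorem pathGraphOn_adj {n x y : ℕ} :
    (pathGraphOn n).Adj x y ↔
      (1 ≤ x ∧ x + 1 ≤ n ∧ y = x + 1) ∨ (1 ≤ y ∧ y + 1 ≤ n ∧ x = y + 1) := by
  simp only [pathGraphOn, SimpleGraph.fromRel_adj]
  omega

/-- For `n ≥ 2`, the word `pathWord n` is 132-avoiding, has letter set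
`{1, …, n}`, and represents the path graph `P n` on `{1, …, n}`. -/
theorem pathWord_represents (n : ℕ) (hn : 2 ≤ n) :
    Avoids132 (pathWord n) ∧ (pathWord n).toFinset = Finset.Icc 1 n ∧
    Represents (pathWord n) (pathGraphOn n) := by
  refine ⟨?_, ?_, fun x y h => ?_, fun x y hne hx hy => ?_⟩
  · obtain ⟨m, rfl⟩ := Nat.exists_eq_add_of_le' hn
    exact avoids132_of_pairwise (pairwise_pathWord (m + 1))
  · ext c
    rw [List.mem_toFinset, mem_pathWord hn, Finset.mem_Icc]
  · rw [pathGraphOn_adj] at h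
    rw [mem_pathWord hn]
    omega
  · rw [mem_pathWord hn] at hx hy
    rw [pathGraphOn_adj]
    rcases hne.lt_or_gt with hlt | hlt
    · rw [alternate_pathWord_iff hx.1 hlt hy.2]
      omega
    · rw [alternate_comm, alternate_pathWord_iff hy.1 hlt hx.2]
      omega
end
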